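/- Let r ≥ 3 be an integer and let H be a finite graph with chromatic number exactly r whose chromatic threshold δ_χ(H) equals (2r-5)/(2r-3). Let δ be a real number with (5r-13)/(5r-8) < δ ≤ (2r-5)/(2r-3), and set f₁(r,δ) = ((-5r²+17r-14)δ² + (10r²-44r+46)δ - 5r² + 27r - 36)/2. Then for every ε > 0 there exist a constant C and an integer n₀ such that every H-free graph G on n ≥ n₀ vertices with minimum degree at least δn and with more than (f₁(r,δ)+ε)n² edges satisfies χ(G) ≤ C. -/

import Mathlib

open SimpleGraph

/-- `H` is contained in `G` as a (not necessarily induced) subgraph. -/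
def ContainsCopy {α β : Type*} (H : SimpleGraph α) (G : SimpleGraph β) : Prop :=
  ∃ f : α → β, Function.Injective f ∧ ∀ ⦃a b⦄, H.Adj a b → G.Adj (f a) (f b)

/-- The chromatic threshold of `H`: the infimum of all `d > 0` such that there is a constant
`C` for which every `H`-free graph `G` on `n` vertices with minimum degree at least `d·n`
satisfies `χ(G) ≤ C`. -/
noncomputable def chromThreshold {α : Type*} (H : SimpleGraph α) : ℝ :=
  sInf {d : ℝ | 0 < d ∧ ∃ C : ℕ, ∀ (n : ℕ) (G : SimpleGraph (Fin n)),
    ¬ ContainsCopy H G → (∀ v, d * n ≤ ((G.neighborSet v).ncard : ℝ)) →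
    G.chromaticNumber ≤ (C : ℕ∞) }

section Helpers

open scoped Classical

/-- ordered clique -/
def Clq {V : Type*} (G : SimpleGraph V) {m : ℕ} (x : Fin m → V) : Prop :=
  ∀ i j, i ≠ j → G.Adj (x i) (x j)

/-- number of ordered `m`-cliques inside `S` -/
noncomputable def cliqCount {V : Type*} [Fintype V] (G : SimpleGraph V) (m : ℕ) (S : Finset V) : ℕ :=
  (Finset.univ.filter (fun x : Fin m → V => Clq G x ∧ ∀ i, x i ∈ S)).card

lemma clq_insertNth {V : Type*} (G : SimpleGraph V) {m : ℕ} (p : Fin (m + 1)) (a : V)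
    (y : Fin m → V) :
    Clq G (p.insertNth a y : Fin (m + 1) → V) ↔ Clq G y ∧ ∀ i, G.Adj a (y i) := by
  constructor
  · intro h
    refine ⟨fun i j hij => ?_, fun i => ?_⟩
    · have := h (p.succAbove i) (p.succAbove j) (by simpa using hij)
      simpa using this
    · have := h p (p.succAbove i) (Fin.ne_succAbove p i)
      simpa using this
  · rintro ⟨h1, h2⟩ i j hij
    rcases Fin.eq_self_or_eq_succAbove p i with rfl | ⟨i', rfl⟩
    · rcases Fin.eq_self_or_eq_succAbove i j with rfl | ⟨j', rfl⟩
      · exact absurd rfl hij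
      · simpa using h2 j'
    · rcases Fin.eq_self_or_eq_succAbove p j with rfl | ⟨j', rfl⟩
      · simpa using (h2 i').symm
      · have : i' ≠ j' := fun h => hij (by rw [h])
        have hfin := h1 i' j' this
        simpa using hfin

/-- splitting a sum over tuples at a coordinate -/
lemma sum_insertNth {V : Type*} [Fintype V] {m : ℕ} (p : Fin (m + 1)) {M : Type*} [AddCommMonoid M]
    (F : (Fin (m + 1) → V) → M) :
    ∑ x, F x = ∑ a, ∑ y : Fin m → V, F (p.insertNth a y) := by
  rw [← (Fin.insertNthEquiv (fun _ : Fin (m + 1) => V) p).sum_comp, Fintype.sum_prod_type]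
  rfl

lemma cliqCount_succ {V : Type*} [Fintype V] (G : SimpleGraph V) (m : ℕ) (S : Finset V) :
    cliqCount G (m + 1) S = ∑ a ∈ S, cliqCount G m (S.filter (fun u => G.Adj a u)) := by
  unfold cliqCount
  rw [Finset.card_filter, sum_insertNth 0, ← Finset.sum_filter_add_sum_filter_not Finset.univ (· ∈ S)]
  have h2 : ∑ a ∈ Finset.univ.filter (fun a => ¬ a ∈ S), ∑ y : Fin m → V,
      (if Clq G ((0 : Fin (m + 1)).insertNth a y : Fin (m + 1) → V) ∧
        ∀ i, ((0 : Fin (m + 1)).insertNth a y : Fin (m + 1) → V) i ∈ S then 1 else 0) = 0 := by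
    apply Finset.sum_eq_zero
    intro a ha
    apply Finset.sum_eq_zero
    intro y _
    rw [if_neg]
    rintro ⟨_, h⟩
    have := h 0
    simp at this ha
    exact ha this
  rw [h2, add_zero]
  have : Finset.univ.filter (fun a => a ∈ S) = S := by ext; simp
  rw [this]
  apply Finset.sum_congr rfl
  intro a ha
  rw [Finset.card_filter]
  apply Finset.sum_congr rfl
  intro y _
  congr 1
  rw [clq_insertNth, Fin.forall_iff_succAbove 0]
  simp only [Fin.insertNth_apply_same, Fin.insertNth_apply_succAbove, Finset.mem_filter]
  apply propext
  constructor
  · rintro ⟨⟨h1, h2⟩, h3, h4⟩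
    exact ⟨h1, fun i => ⟨h4 i, h2 i⟩⟩
  · rintro ⟨h1, h2⟩
    exact ⟨⟨h1, fun i => (h2 i).2⟩, ha, fun i => (h2 i).1⟩

/-- Robust Caro--Wei. -/
lemma caro_wei {V : Type*} [Fintype V] (G : SimpleGraph V) (nn : V → ℝ) (c η : ℝ) (hc : 0 < c)
    (hη : 0 ≤ η) (hnn : ∀ v, c ≤ nn v)
    (hdeg : ∀ v, ((Finset.univ.filter (fun u => ¬ G.Adj v u)).card : ℝ) ≤ nn v) :
    ∀ (j : ℕ) (S : Finset V), (j : ℝ) * (1 + η / c) + η / c ≤ ∑ v ∈ S, 1 / nn v →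
      η ^ (j + 1) ≤ (cliqCount G (j + 1) S : ℝ) := by
  have hpos : ∀ v, 0 < nn v := fun v => lt_of_lt_of_le hc (hnn v)
  have hinv : ∀ v, 1 / nn v ≤ 1 / c := fun v => one_div_le_one_div_of_le hc (hnn v)
  have hsmall : ∀ S : Finset V, ∑ v ∈ S, 1 / nn v ≤ (S.card : ℝ) / c := by
    intro S
    calc ∑ v ∈ S, 1 / nn v ≤ ∑ v ∈ S, 1 / c := Finset.sum_le_sum (fun v _ => hinv v)
      _ = _ := by simp [div_eq_mul_inv]
  have hbig : ∀ S : Finset V, η / c ≤ ∑ v ∈ S, 1 / nn v → η ≤ S.card := by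
    intro S h
    have := h.trans (hsmall S)
    exact (div_le_div_iff_of_pos_right hc).1 this
  intro j
  induction j with
  | zero =>
    intro S h
    have h1 : η ≤ S.card := hbig S (by simpa using h)
    have h2 : cliqCount G 1 S = S.card := by
      rw [cliqCount_succ]
      have : ∀ T : Finset V, cliqCount G 0 T = 1 := by
        intro T
        unfold cliqCount
        rw [Finset.filter_true_of_mem]
        · simp
        · intro x _
          exact ⟨fun i => i.elim0, fun i => i.elim0⟩
      simp [this]
    simp only [zero_add, pow_one]
    rw [h2]; exact h1
  | succ j ih =>
    intro S h
    have hηc : 0 ≤ η / c := div_nonneg hη hc.le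
    have hS : η ≤ S.card := by
      apply hbig
      refine le_trans ?_ h
      have : 0 ≤ ((j + 1 : ℕ) : ℝ) * (1 + η / c) := by positivity
      linarith
    set good := S.filter (fun x => ((S.filter (fun y => nn y < nn x)).card : ℝ) < η ) with hgood
    by_cases hη0 : η = 0
    · rw [hη0]; simp
    have hη' : 0 < η := lt_of_le_of_ne hη (Ne.symm hη0)
    have hgc : η ≤ good.card := by
      by_cases he : (S \ good).Nonempty
      · obtain ⟨x, hx, hxm⟩ := Finset.exists_min_image (S \ good) nn he
        rw [Finset.mem_sdiff] at hx
        have h1 : η ≤ ((S.filter (fun y => nn y < nn x)).card : ℝ) := by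
          by_contra hlt
          exact hx.2 (Finset.mem_filter.2 ⟨hx.1, not_le.1 hlt⟩)
        refine h1.trans ?_
        exact_mod_cast Finset.card_le_card (fun y hy => by
          rw [Finset.mem_filter] at hy
          by_contra hyg
          exact absurd hy.2 (not_lt.2 (hxm y (Finset.mem_sdiff.2 ⟨hy.1, hyg⟩))))
      · rw [Finset.not_nonempty_iff_eq_empty, Finset.sdiff_eq_empty_iff_subset] at he
        exact hS.trans (by exact_mod_cast Finset.card_le_card he)
    have hstep : ∀ x ∈ good, η ^ (j + 1) ≤ (cliqCount G (j + 1) (S.filter (fun u => G.Adj x u)) : ℝ) := by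
      intro x hx
      apply ih
      have hx2 := (Finset.mem_filter.1 hx).2
      have e1 := Finset.sum_filter_add_sum_filter_not S (fun u => G.Adj x u) (fun v => 1 / nn v)
      have e2 := Finset.sum_filter_add_sum_filter_not (S.filter (fun u => ¬ G.Adj x u))
        (fun v => nn v < nn x) (fun v => 1 / nn v)
      have b1 : ∑ v ∈ (S.filter (fun u => ¬ G.Adj x u)).filter (fun v => nn v < nn x), 1 / nn v
          ≤ η / c := by
        refine (hsmall _).trans ?_
        apply div_le_div_of_nonneg_right _ hc.le
        refine le_trans ?_ hx2.le
        exact_mod_cast Finset.card_le_card (fun y hy => by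
          simp only [Finset.mem_filter] at hy ⊢
          exact ⟨hy.1.1, hy.2⟩)
      have b2 : ∑ v ∈ (S.filter (fun u => ¬ G.Adj x u)).filter (fun v => ¬ nn v < nn x), 1 / nn v
          ≤ 1 := by
        calc _ ≤ ∑ v ∈ (S.filter (fun u => ¬ G.Adj x u)).filter (fun v => ¬ nn v < nn x), 1 / nn x := by
              apply Finset.sum_le_sum
              intro v hv
              simp only [Finset.mem_filter, not_lt] at hv
              exact one_div_le_one_div_of_le (hpos x) hv.2
          _ = (((S.filter (fun u => ¬ G.Adj x u)).filter (fun v => ¬ nn v < nn x)).card : ℝ) / nn x := by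
              simp [div_eq_mul_inv]
          _ ≤ 1 := by
              rw [div_le_one (hpos x)]
              refine le_trans ?_ (hdeg x)
              exact_mod_cast Finset.card_le_card (fun y hy => by
                simp only [Finset.mem_filter] at hy ⊢
                exact ⟨Finset.mem_univ _, hy.1.2⟩)
      push_cast at h
      linarith
    rw [cliqCount_succ]
    push_cast
    calc η ^ (j + 1 + 1) = η * η ^ (j + 1) := by ring
      _ ≤ good.card * η ^ (j + 1) := by gcongr
      _ = ∑ x ∈ good, η ^ (j + 1) := by simp
      _ ≤ ∑ x ∈ good, (cliqCount G (j + 1) (S.filter (fun u => G.Adj x u)) : ℝ) :=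
          Finset.sum_le_sum hstep
      _ ≤ _ := Finset.sum_le_sum_of_subset_of_nonneg (Finset.filter_subset _ _)
          (fun _ _ _ => Nat.cast_nonneg _)

/-- Supersaturation for blow-ups. -/
lemma supersat (s : ℕ) : ∀ (m : ℕ) (γ : ℝ), 0 < γ → ∃ ε : ℝ, 0 < ε ∧
    ∀ (V : Type) [Fintype V] [Nonempty V] (g : (Fin m → V) → Prop),
      γ * (Fintype.card V : ℝ) ^ m ≤ ((Finset.univ.filter g).card : ℝ) →
      ε * (Fintype.card V : ℝ) ^ (m * s) ≤ ((Finset.univ.filter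
        (fun z : Fin m → Fin s → V => ∀ σ : Fin m → Fin s, g (fun i => z i (σ i)))).card : ℝ) := by
  intro m
  induction m with
  | zero =>
    intro γ hγ
    refine ⟨1, one_pos, ?_⟩
    intro V _ _ g hg
    have h1 : 0 < (Finset.univ.filter g).card := by
      have : (0 : ℝ) < ((Finset.univ.filter g).card : ℝ) := lt_of_lt_of_le (by simpa using hγ) hg
      exact_mod_cast this
    obtain ⟨x, hx⟩ := Finset.card_pos.1 h1
    rw [Finset.filter_true_of_mem]
    · simp
    · intro z _ σ
      rw [Finset.mem_filter] at hx
      convert hx.2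
  | succ m ih =>
    intro γ hγ
    obtain ⟨ε, hε, H⟩ := ih (γ ^ s / 2) (by positivity)
    refine ⟨γ ^ s / 2 * ε, by positivity, ?_⟩
    intro V _ _ g hg
    set N : ℝ := (Fintype.card V : ℝ) with hN
    have hNpos : 0 < N := by rw [hN]; exact_mod_cast Fintype.card_pos
    set d : (Fin m → V) → ℕ := fun y => (Finset.univ.filter (fun a => g (Fin.cons a y))).card with hd
    set e : (Fin s → V) → ℕ :=
      fun v => (Finset.univ.filter (fun y : Fin m → V => ∀ i, g (Fin.cons (v i) y))).card with he
    have hsum : ((Finset.univ.filter g).card : ℝ) = ∑ y, (d y : ℝ) := by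
      rw [Finset.card_filter, sum_insertNth 0, Finset.sum_comm]
      push_cast
      apply Finset.sum_congr rfl
      intro y _
      simp only [hd, Finset.card_filter]
      push_cast
      simp [Fin.insertNth_zero']
    have hpow : γ ^ s * N ^ (s + m) ≤ ∑ y, (d y : ℝ) ^ s := by
      rcases s with _ | s
      · simp [hN]
      · have := pow_sum_div_card_le_sum_pow (s := (Finset.univ : Finset (Fin m → V)))
          (f := fun y => (d y : ℝ)) (fun _ _ => Nat.cast_nonneg _) s
        refine le_trans ?_ this
        rw [← hsum, le_div_iff₀ (by simp [← hN]; positivity)]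
        have h2 : (γ * N ^ (m + 1)) ^ (s + 1) ≤ ((Finset.univ.filter g).card : ℝ) ^ (s + 1) := by
          gcongr
        refine le_trans (le_of_eq ?_) h2
        simp [← hN]
        ring
    have hdbl : ∑ y, (d y : ℝ) ^ s = ∑ v, (e v : ℝ) := by
      have : ∀ y, (d y : ℝ) ^ s = ∑ v : Fin s → V, if ∀ i, g (Fin.cons (v i) y) then (1 : ℝ) else 0 := by
        intro y
        have h1 : (d y : ℝ) = ∑ a, if g (Fin.cons a y) then (1 : ℝ) else 0 := by
          simp [hd]
        rw [h1, Fintype.sum_pow]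
        apply Finset.sum_congr rfl
        intro v _
        rw [Finset.prod_ite_zero]
        simp
      simp_rw [this]
      rw [Finset.sum_comm]
      simp [he]
    rw [hdbl] at hpow
    set heavy := Finset.univ.filter (fun v => γ ^ s / 2 * N ^ m ≤ (e v : ℝ)) with hheavy
    have hle : ∀ v, (e v : ℝ) ≤ N ^ m := by
      intro v
      have : e v ≤ Fintype.card (Fin m → V) := Finset.card_le_univ _
      calc (e v : ℝ) ≤ (Fintype.card (Fin m → V) : ℝ) := by exact_mod_cast this
        _ = N ^ m := by simp [hN]
    have hheavyc : γ ^ s / 2 * N ^ s ≤ (heavy.card : ℝ) := by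
      have h1 : ∑ v, (e v : ℝ) ≤ heavy.card * N ^ m + N ^ s * (γ ^ s / 2 * N ^ m) := by
        rw [← Finset.sum_filter_add_sum_filter_not Finset.univ (fun v => γ ^ s / 2 * N ^ m ≤ (e v : ℝ))]
        apply add_le_add
        · calc _ ≤ ∑ v ∈ heavy, N ^ m := Finset.sum_le_sum (fun v _ => hle v)
            _ = _ := by simp
        · calc _ ≤ ∑ v ∈ Finset.univ.filter (fun v => ¬ γ ^ s / 2 * N ^ m ≤ (e v : ℝ)), (γ ^ s / 2 * N ^ m) := by
                apply Finset.sum_le_sum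
                intro v hv
                exact (not_le.1 (Finset.mem_filter.1 hv).2).le
            _ ≤ ∑ v : Fin s → V, (γ ^ s / 2 * N ^ m) := by
                apply Finset.sum_le_sum_of_subset_of_nonneg (Finset.filter_subset _ _)
                intros; positivity
            _ = _ := by simp [hN]
      have h2 := hpow.trans h1
      rw [pow_add] at h2
      have h3 : (γ ^ s / 2 * N ^ s) * N ^ m ≤ heavy.card * N ^ m := by linarith
      exact le_of_mul_le_mul_right h3 (by positivity)
    have hfin : (((Finset.univ.filter
        (fun z : Fin (m + 1) → Fin s → V => ∀ σ : Fin (m + 1) → Fin s, g (fun i => z i (σ i)))).card : ℕ) : ℝ)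
        = ∑ v : Fin s → V, ((Finset.univ.filter
        (fun z : Fin m → Fin s → V => ∀ σ : Fin m → Fin s, ∀ i, g (Fin.cons (v i) (fun i => z i (σ i))))).card : ℝ) := by
      rw [Finset.card_filter, sum_insertNth 0]
      push_cast
      apply Finset.sum_congr rfl
      intro v _
      rw [Finset.card_filter]
      push_cast
      apply Finset.sum_congr rfl
      intro z _
      congr 1
      apply propext
      constructor
      · intro h σ i
        have := h (Fin.cons i σ)
        convert this using 1
        funext k
        refine Fin.cases ?_ (fun k => ?_) k <;> simp [Fin.insertNth_zero']
      · intro h σ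
        have := h (fun i => σ i.succ) (σ 0)
        convert this using 1
        funext k
        refine Fin.cases ?_ (fun k => ?_) k <;> simp [Fin.insertNth_zero']
    rw [hfin]
    calc γ ^ s / 2 * ε * N ^ ((m + 1) * s) = (γ ^ s / 2 * N ^ s) * (ε * N ^ (m * s)) := by ring
      _ ≤ heavy.card * (ε * N ^ (m * s)) := by gcongr
      _ = ∑ v ∈ heavy, (ε * N ^ (m * s)) := by simp
      _ ≤ ∑ v ∈ heavy, ((Finset.univ.filter
        (fun z : Fin m → Fin s → V => ∀ σ : Fin m → Fin s, ∀ i, g (Fin.cons (v i) (fun i => z i (σ i))))).card : ℝ) := by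
          apply Finset.sum_le_sum
          intro v hv
          have h1 : γ ^ s / 2 * N ^ m ≤ (e v : ℝ) := (Finset.mem_filter.1 hv).2
          have h2 := H V (fun y => ∀ i, g (Fin.cons (v i) y)) (by convert h1)
          refine h2.trans (le_of_eq ?_)
          congr!
      _ ≤ _ := Finset.sum_le_sum_of_subset_of_nonneg (Finset.filter_subset _ _)
          (fun _ _ _ => Nat.cast_nonneg _)

/-- complete `m`-partite blow-ups with parts of size `s`. -/
def IsBlow {V : Type*} (G : SimpleGraph V) {m s : ℕ} (z : Fin m → Fin s → V) : Prop :=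
  (∀ i j, i ≠ j → ∀ a b, G.Adj (z i a) (z j b)) ∧ ∀ i, Function.Injective (z i)

/-- blow-ups inside `S` -/
noncomputable def blowSet {V : Type*} [Fintype V] (G : SimpleGraph V) (m s : ℕ) (S : Finset V) :
    Finset (Fin m → Fin s → V) :=
  Finset.univ.filter (fun z => IsBlow G z ∧ ∀ i a, z i a ∈ S)

lemma card_coincide {V : Type} [Fintype V] [Nonempty V] (m s : ℕ) (i : Fin m) (a b : Fin s) (hab : a ≠ b) :
    ((Finset.univ.filter (fun z : Fin m → Fin s → V => z i a = z i b)).card : ℝ)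
      ≤ (Fintype.card V : ℝ) ^ (m * s) / (Fintype.card V : ℝ) := by
  have hpos : (0 : ℝ) < Fintype.card V := by exact_mod_cast Fintype.card_pos
  have h1 : (Finset.univ.filter (fun z : Fin m → Fin s → V => z i a = z i b)).card ≤
      (Finset.univ : Finset ({p : Fin m × Fin s // p ≠ (i, a)} → V)).card := by
    apply Finset.card_le_card_of_injOn (fun z p => z p.1.1 p.1.2)
    · intro z _; simp
    · intro z hz w hw h
      simp only [Finset.coe_filter, Finset.mem_univ, true_and, Set.mem_ofPred_eq] at hz hw
      have key : ∀ p : Fin m × Fin s, p ≠ (i, a) → z p.1 p.2 = w p.1 p.2 := by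
        intro p hp
        exact congrFun h ⟨p, hp⟩
      funext i' a'
      by_cases hp : (i', a') = (i, a)
      · obtain ⟨rfl, rfl⟩ := Prod.mk.inj hp
        rw [hz, hw]
        exact key (i', b) (fun h => hab (Prod.mk.inj h).2.symm)
      · exact key (i', a') hp
  have h2 : (Finset.univ : Finset ({p : Fin m × Fin s // p ≠ (i, a)} → V)).card
      = Fintype.card V ^ (m * s - 1) := by
    rw [Finset.card_univ, Fintype.card_fun]
    congr 1
    rw [Fintype.card_subtype_compl]
    simp
  rw [h2] at h1
  have h3 : (Fintype.card V : ℝ) ^ (m * s) / (Fintype.card V : ℝ) = (Fintype.card V : ℝ) ^ (m * s - 1) := by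
    have : 0 < m * s := Nat.mul_pos (i.pos) (a.pos)
    rw [div_eq_iff hpos.ne', ← pow_succ]
    congr 1; omega
  rw [h3]
  exact_mod_cast h1

lemma many_blow (m s : ℕ) (γ : ℝ) (hγ : 0 < γ) : ∃ ε : ℝ, 0 < ε ∧ ∃ n₀ : ℕ, ∀ (V : Type) [Fintype V], n₀ ≤ Fintype.card V →
    ∀ (G : SimpleGraph V) (S : Finset V), γ * (Fintype.card V : ℝ) ^ m ≤ cliqCount G m S →
      ε * (Fintype.card V : ℝ) ^ (m * s) ≤ ((blowSet G m s S).card : ℝ) := by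
  obtain ⟨ε, hε, H⟩ := supersat s m γ hγ
  obtain ⟨n₁, hn₁⟩ := exists_nat_gt ((m * s * s : ℝ) / (ε / 2))
  refine ⟨ε / 2, by positivity, n₁ + 1, ?_⟩
  intro V _ hn G S hS
  set n := Fintype.card V with hnV
  have hn0 : 0 < n := by omega
  have : Nonempty V := Fintype.card_pos_iff.1 hn0
  have h1 := H V (fun x => Clq G x ∧ ∀ i, x i ∈ S) (by unfold cliqCount at hS; convert hS)
  set A := Finset.univ.filter (fun z : Fin m → Fin s → V =>
    ∀ σ : Fin m → Fin s, Clq G (fun i => z i (σ i)) ∧ ∀ i, z i (σ i) ∈ S) with hA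
  set Bd := (Finset.univ : Finset (Fin m × Fin s × Fin s)).biUnion (fun p =>
    if p.2.1 = p.2.2 then ∅ else
      Finset.univ.filter (fun z : Fin m → Fin s → V => z p.1 p.2.1 = z p.1 p.2.2)) with hBd
  have hsub : A ⊆ blowSet G m s S ∪ Bd := by
    intro z hz
    rw [Finset.mem_union]
    by_contra hcon
    push Not at hcon
    obtain ⟨hc1, hc2⟩ := hcon
    apply hc1
    have hz' := (Finset.mem_filter.1 hz).2
    unfold blowSet
    rw [Finset.mem_filter]
    refine ⟨Finset.mem_univ _, ⟨?_, ?_⟩, ?_⟩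
    · intro i j hij a b
      have := (hz' (fun k => if k = i then a else b)).1 i j hij
      simpa [hij.symm] using this
    · intro i a b hab
      by_contra hne
      apply hc2
      rw [hBd, Finset.mem_biUnion]
      refine ⟨(i, a, b), Finset.mem_univ _, ?_⟩
      simp [hne, hab]
    · intro i a
      exact (hz' (fun _ => a)).2 i
  have hBc : (Bd.card : ℝ) ≤ m * s * s * ((n : ℝ) ^ (m * s) / n) := by
    calc (Bd.card : ℝ) ≤ ∑ p : Fin m × Fin s × Fin s, ((if p.2.1 = p.2.2 then ∅ else
      Finset.univ.filter (fun z : Fin m → Fin s → V => z p.1 p.2.1 = z p.1 p.2.2)).card : ℝ) := by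
          exact_mod_cast Finset.card_biUnion_le
      _ ≤ ∑ p : Fin m × Fin s × Fin s, ((n : ℝ) ^ (m * s) / n) := by
          apply Finset.sum_le_sum
          intro p _
          split_ifs with h
          · simp; positivity
          · have := card_coincide (V := V) m s p.1 p.2.1 p.2.2 h
            exact this
      _ = _ := by
          rw [Finset.sum_const, nsmul_eq_mul]
          simp [mul_assoc]
  have hAc : ε * (n : ℝ) ^ (m * s) ≤ (A.card : ℝ) := by
    refine h1.trans (le_of_eq ?_)
    congr!
  have hAle : (A.card : ℝ) ≤ (blowSet G m s S).card + Bd.card := by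
    exact_mod_cast (Finset.card_le_card hsub).trans (Finset.card_union_le _ _)
  have hnR : (0 : ℝ) < n := by exact_mod_cast hn0
  have hsm : (m * s * s : ℝ) * ((n : ℝ) ^ (m * s) / n) ≤ ε / 2 * (n : ℝ) ^ (m * s) := by
    have h3 : (m * s * s : ℝ) ≤ ε / 2 * n := by
      have h4 : (m * s * s : ℝ) / (ε / 2) ≤ n := hn₁.le.trans (by exact_mod_cast (by omega))
      rw [div_le_iff₀ (by positivity)] at h4
      linarith
    calc (m * s * s : ℝ) * ((n : ℝ) ^ (m * s) / n) = (m * s * s : ℝ) / n * (n : ℝ) ^ (m * s) := by ring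
      _ ≤ ε / 2 * (n : ℝ) ^ (m * s) := by
        apply mul_le_mul_of_nonneg_right _ (by positivity)
        rw [div_le_iff₀ hnR]; exact h3
  linarith

/-- Assembling a copy of `H`. -/
lemma embed_copy {α V : Type*} [Fintype α] (H : SimpleGraph α) (G : SimpleGraph V) {m : ℕ}
    (z : Fin m → Fin (Fintype.card α) → V) (hz : IsBlow G z) (col : α → Option (Fin m))
    (hcol : ∀ a b i, col a = some i → col b = some i → ¬ H.Adj a b)
    (f : α → V) (hinj : ∀ a b, col a = none → col b = none → f a = f b → a = b)
    (hf : ∀ a b, col a = none → col b = none → H.Adj a b → G.Adj (f a) (f b))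
    (hfz : ∀ a, col a = none → ∀ i j, G.Adj (f a) (z i j)) : ContainsCopy H G := by
  let e := Fintype.equivFin α
  let φ : α → V := fun a => match col a with
    | none => f a
    | some i => z i (e a)
  have h0 : ∀ a, col a = none → φ a = f a := by
    intro a h; simp only [φ, h]
  have h1 : ∀ a i, col a = some i → φ a = z i (e a) := by
    intro a i h; simp only [φ, h]
  have hadj : ∀ a b, col a ≠ col b → G.Adj (φ a) (φ b) := by
    intro a b hab
    rcases ha : col a with _ | i <;> rcases hb : col b with _ | j
    · rw [ha, hb] at hab; exact absurd rfl hab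
    · rw [h0 a ha, h1 b j hb]; exact hfz a ha _ _
    · rw [h0 b hb, h1 a i ha]; exact (hfz b hb _ _).symm
    · rw [h1 a i ha, h1 b j hb]
      apply hz.1
      rintro rfl
      rw [ha, hb] at hab; exact absurd rfl hab
  refine ⟨φ, ?_, ?_⟩
  · intro a b hab
    by_cases hc : col a = col b
    · rcases ha : col a with _ | i
      · have hb : col b = none := by rw [← hc, ha]
        rw [h0 a ha, h0 b hb] at hab
        exact hinj a b ha hb hab
      · have hb : col b = some i := by rw [← hc, ha]
        rw [h1 a i ha, h1 b i hb] at hab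
        exact e.injective (hz.2 i hab)
    · exact absurd hab (hadj a b hc).ne
  · intro a b hab
    by_cases hc : col a = col b
    · rcases ha : col a with _ | i
      · have hb : col b = none := by rw [← hc, ha]
        rw [h0 a ha, h0 b hb]
        exact hf a b ha hb hab
      · have hb : col b = some i := by rw [← hc, ha]
        exact absurd hab (hcol a b i ha hb)
    · exact hadj a b hc

/-- A 1-degenerate graph embeds in a set with large minimum degree. -/
lemma embed_forest {α V : Type*} [Fintype α] (H : SimpleGraph α) (G : SimpleGraph V) [Fintype V]
    (F : Finset α)
    (hF : ∀ T : Finset α, T ⊆ F → T.Nonempty → ∃ a ∈ T, (T.filter (fun b => H.Adj a b)).card ≤ 1)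
    (W : Finset V) (hW : W.Nonempty)
    (hdeg : ∀ u ∈ W, Fintype.card α ≤ (W.filter (fun v => G.Adj u v)).card) :
    ∀ T : Finset α, T ⊆ F → ∃ f : α → V, (∀ a ∈ T, f a ∈ W) ∧
      (∀ a ∈ T, ∀ b ∈ T, f a = f b → a = b) ∧ (∀ a ∈ T, ∀ b ∈ T, H.Adj a b → G.Adj (f a) (f b)) := by
  intro T
  induction hn : T.card using Nat.strong_induction_on generalizing T with
  | _ n ih =>
    intro hT
    rcases T.eq_empty_or_nonempty with rfl | hne
    · exact ⟨fun _ => hW.choose, by simp, by simp, by simp⟩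
    obtain ⟨a, haT, ha⟩ := hF T hT hne
    have hcardlt : (T.erase a).card < Fintype.card α := by
      have h1 := Finset.card_erase_lt_of_mem haT
      have h2 := Finset.card_le_univ T
      omega
    obtain ⟨f, hf1, hf2, hf3⟩ := ih (T.erase a).card (by
      rw [← hn]; exact Finset.card_erase_lt_of_mem haT) (T.erase a) rfl
      ((Finset.erase_subset _ _).trans hT)
    have hx : ∃ x ∈ W, x ∉ (T.erase a).image f ∧ ∀ b ∈ T, H.Adj a b → G.Adj x (f b) := by
      have himg : ((T.erase a).image f).card < Fintype.card α :=
        lt_of_le_of_lt Finset.card_image_le hcardlt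
      rcases (T.filter (fun b => H.Adj a b)).eq_empty_or_nonempty with he | ⟨b, hb⟩
      · obtain ⟨w, hw⟩ := hW
        have : ((T.erase a).image f).card < W.card :=
          lt_of_lt_of_le himg ((hdeg w hw).trans (Finset.card_filter_le _ _))
        obtain ⟨x, hx, hx'⟩ := Finset.exists_mem_notMem_of_card_lt_card this
        refine ⟨x, hx, hx', ?_⟩
        intro b hb hab
        have : b ∈ T.filter (fun b => H.Adj a b) := Finset.mem_filter.2 ⟨hb, hab⟩
        rw [he] at this
        simp at this
      · rw [Finset.mem_filter] at hb
        have hba : b ∈ T.erase a := Finset.mem_erase.2 ⟨hb.2.ne', hb.1⟩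
        have := lt_of_lt_of_le himg (hdeg (f b) (hf1 b hba))
        obtain ⟨x, hx, hx'⟩ := Finset.exists_mem_notMem_of_card_lt_card this
        rw [Finset.mem_filter] at hx
        refine ⟨x, hx.1, hx', ?_⟩
        intro b' hb' hab'
        have : b' = b := Finset.card_le_one.1 ha b' (Finset.mem_filter.2 ⟨hb', hab'⟩) b
          (Finset.mem_filter.2 hb)
        rw [this]
        exact hx.2.symm
    obtain ⟨x, hxW, hxn, hxadj⟩ := hx
    have hfn : ∀ b ∈ T, b ≠ a → f b ≠ x := by
      intro b hb hba h
      exact hxn (Finset.mem_image.2 ⟨b, Finset.mem_erase.2 ⟨hba, hb⟩, h⟩)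
    refine ⟨Function.update f a x, ?_, ?_, ?_⟩
    · intro b hb
      by_cases hba : b = a
      · subst hba; simpa using hxW
      · rw [Function.update_of_ne hba]; exact hf1 b (Finset.mem_erase.2 ⟨hba, hb⟩)
    · intro b hb c hc h
      by_cases hba : b = a <;> by_cases hca : c = a
      · rw [hba, hca]
      · subst hba
        rw [Function.update_self, Function.update_of_ne hca] at h
        exact absurd h.symm (hfn c hc hca)
      · subst hca
        rw [Function.update_self, Function.update_of_ne hba] at h
        exact absurd h (hfn b hb hba)
      · rw [Function.update_of_ne hca, Function.update_of_ne hba] at h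
        exact hf2 b (Finset.mem_erase.2 ⟨hba, hb⟩) c (Finset.mem_erase.2 ⟨hca, hc⟩) h
    · intro b hb c hc h
      by_cases hba : b = a <;> by_cases hca : c = a
      · subst hba; subst hca; exact absurd h (H.loopless.irrefl _)
      · subst hba
        rw [Function.update_self, Function.update_of_ne hca]
        exact hxadj c hc h
      · subst hca
        rw [Function.update_self, Function.update_of_ne hba]
        exact (hxadj b hb h.symm).symm
      · rw [Function.update_of_ne hca, Function.update_of_ne hba]
        exact hf3 b (Finset.mem_erase.2 ⟨hba, hb⟩) c (Finset.mem_erase.2 ⟨hca, hc⟩) h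

/-- dense sets contain subsets of large minimum degree -/
lemma exists_min_deg {V : Type*} [Fintype V] (G : SimpleGraph V) (s : ℕ) : ∀ T : Finset V, T.Nonempty →
    2 * s * T.card ≤ ∑ u ∈ T, (T.filter (fun v => G.Adj u v)).card →
    ∃ W ⊆ T, W.Nonempty ∧ ∀ u ∈ W, s ≤ (W.filter (fun v => G.Adj u v)).card := by
  intro T
  induction hn : T.card using Nat.strong_induction_on generalizing T with
  | _ n ih =>
    intro hne hsum
    by_cases hall : ∀ u ∈ T, s ≤ (T.filter (fun v => G.Adj u v)).card
    · exact ⟨T, subset_rfl, hne, hall⟩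
    push Not at hall
    obtain ⟨u, hu, hlt⟩ := hall
    have hcard : (T.erase u).card + 1 = T.card := Finset.card_erase_add_one hu
    have hdec : ∀ w ∈ T.erase u, (T.filter (fun v => G.Adj w v)).card =
        ((T.erase u).filter (fun v => G.Adj w v)).card + (if G.Adj u w then 1 else 0) := by
      intro w _
      rw [Finset.filter_erase]
      split_ifs with h
      · rw [Finset.card_erase_add_one]
        exact Finset.mem_filter.2 ⟨hu, h.symm⟩
      · rw [Finset.erase_eq_of_notMem, add_zero]
        intro hh
        exact h (Finset.mem_filter.1 hh).2.symm
    have hs2 : ∑ w ∈ T.erase u, (if G.Adj u w then 1 else 0) ≤ (T.filter (fun v => G.Adj u v)).card := by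
      rw [← Finset.card_filter]
      exact Finset.card_le_card (Finset.filter_subset_filter _ (Finset.erase_subset _ _))
    have hs := Finset.add_sum_erase T (fun w => (T.filter (fun v => G.Adj w v)).card) hu
    rw [Finset.sum_congr rfl hdec, Finset.sum_add_distrib] at hs
    have hmul : 2 * s * T.card = 2 * s * (T.erase u).card + 2 * s := by rw [← hcard]; ring
    have hne' : (T.erase u).Nonempty := by
      rw [Finset.nonempty_iff_ne_empty]
      intro he
      rw [he] at hs hmul
      simp at hs hmul
      rw [hn] at hmul
      omega
    rw [hn] at hmul
    obtain ⟨W, hW, h2⟩ := ih (T.erase u).card (by omega) (T.erase u) rfl hne' (by omega)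
    exact ⟨W, hW.trans (Finset.erase_subset _ _), h2⟩

/-- degenerate graphs have bounded chromatic number -/
lemma color_degenerate {V : Type*} [Fintype V] (G : SimpleGraph V) (L : ℕ) : ∀ W : Finset V,
    (∀ T ⊆ W, T.Nonempty → ∃ v ∈ T, (T.filter (fun u => G.Adj v u)).card ≤ L) →
    ∃ c : V → Fin (L + 1), ∀ u ∈ W, ∀ v ∈ W, G.Adj u v → c u ≠ c v := by
  intro W
  induction hn : W.card using Nat.strong_induction_on generalizing W with
  | _ n ih =>
    intro hW
    rcases W.eq_empty_or_nonempty with rfl | hne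
    · exact ⟨fun _ => 0, by simp⟩
    obtain ⟨a, ha, hdeg⟩ := hW W subset_rfl hne
    obtain ⟨c, hc⟩ := ih (W.erase a).card (by rw [← hn]; exact Finset.card_erase_lt_of_mem ha)
      (W.erase a) rfl (fun T hT => hW T (hT.trans (Finset.erase_subset _ _)))
    have : ((W.filter (fun u => G.Adj a u)).image c).card < (Finset.univ : Finset (Fin (L + 1))).card := by
      refine lt_of_le_of_lt Finset.card_image_le ?_
      simp; omega
    obtain ⟨x, _, hx⟩ := Finset.exists_mem_notMem_of_card_lt_card this
    have hx' : ∀ u ∈ W, G.Adj a u → c u ≠ x := by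
      intro u hu hau h
      exact hx (Finset.mem_image.2 ⟨u, Finset.mem_filter.2 ⟨hu, hau⟩, h⟩)
    refine ⟨Function.update c a x, ?_⟩
    intro u hu v hv huv
    by_cases hua : u = a <;> by_cases hva : v = a
    · subst hua; subst hva; exact absurd huv (G.loopless.irrefl _)
    · subst hua
      rw [Function.update_self, Function.update_of_ne hva]
      exact (hx' v hv huv).symm
    · subst hva
      rw [Function.update_self, Function.update_of_ne hua]
      exact hx' u hu huv.symm
    · rw [Function.update_of_ne hua, Function.update_of_ne hva]
      exact hc u (Finset.mem_erase.2 ⟨hua, hu⟩) v (Finset.mem_erase.2 ⟨hva, hv⟩) huv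

/-- neighbourhood as a finset -/
noncomputable def nb {V : Type*} [Fintype V] (G : SimpleGraph V) (u : V) : Finset V :=
  Finset.univ.filter (fun v => G.Adj u v)

lemma mem_nb {V : Type*} [Fintype V] (G : SimpleGraph V) (u v : V) : v ∈ nb G u ↔ G.Adj u v := by
  simp [nb]

lemma mem_blowSet {V : Type*} [Fintype V] (G : SimpleGraph V) (m s : ℕ) (S : Finset V)
    (z : Fin m → Fin s → V) : z ∈ blowSet G m s S ↔ IsBlow G z ∧ ∀ i a, z i a ∈ S := by
  simp [blowSet]

lemma exceptional_bound {α : Type*} [Fintype α] (H : SimpleGraph α) (m : ℕ)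
    (hH : H.Colorable (m + 1)) {V : Type} [Fintype V] [Nonempty V] (G : SimpleGraph V)
    (hG : ¬ ContainsCopy H G) (ε : ℝ) (B : Finset V)
    (hB : ∀ w ∈ B, ε * (Fintype.card V : ℝ) ^ (m * Fintype.card α) ≤
      ((blowSet G m (Fintype.card α) (nb G w)).card : ℝ)) :
    ε * B.card ≤ Fintype.card α := by
  set s := Fintype.card α with hs
  by_contra hcon
  push Not at hcon
  have hN : (0 : ℝ) < (Fintype.card V : ℝ) ^ (m * s) := by
    have : (0 : ℝ) < Fintype.card V := by exact_mod_cast Fintype.card_pos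
    positivity
  have hsum : ∑ w ∈ B, ((blowSet G m s (nb G w)).card : ℝ) =
      ∑ z : Fin m → Fin s → V, ((B.filter (fun w => z ∈ blowSet G m s (nb G w))).card : ℝ) := by
    have : ∀ w ∈ B, ((blowSet G m s (nb G w)).card : ℝ) =
        ∑ z : Fin m → Fin s → V, if z ∈ blowSet G m s (nb G w) then (1 : ℝ) else 0 := by
      intro w _; simp
    rw [Finset.sum_congr rfl this, Finset.sum_comm]
    simp
  have hlow : ε * B.card * (Fintype.card V : ℝ) ^ (m * s) ≤ ∑ w ∈ B, ((blowSet G m s (nb G w)).card : ℝ) := by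
    calc ε * B.card * (Fintype.card V : ℝ) ^ (m * s) = ∑ w ∈ B, ε * (Fintype.card V : ℝ) ^ (m * s) := by
          rw [Finset.sum_const, nsmul_eq_mul]; ring
      _ ≤ _ := Finset.sum_le_sum hB
  have hlt : ∑ z : Fin m → Fin s → V, (s : ℝ) <
      ∑ z : Fin m → Fin s → V, ((B.filter (fun w => z ∈ blowSet G m s (nb G w))).card : ℝ) := by
    rw [← hsum]
    refine lt_of_lt_of_le ?_ hlow
    have : ∑ z : Fin m → Fin s → V, (s : ℝ) = s * (Fintype.card V : ℝ) ^ (m * s) := by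
      rw [Finset.sum_const, nsmul_eq_mul, Finset.card_univ]
      simp [← pow_mul]
      rw [mul_comm s m]; ring
    rw [this]
    exact mul_lt_mul_of_pos_right hcon hN
  obtain ⟨z, _, hz⟩ := Finset.exists_lt_of_sum_lt hlt
  set Bz := B.filter (fun w => z ∈ blowSet G m s (nb G w)) with hBz
  have hz' : s < Bz.card := by exact_mod_cast hz
  have hmem : ∀ w ∈ Bz, IsBlow G z ∧ ∀ i a, G.Adj w (z i a) := by
    intro w hw
    have := (Finset.mem_filter.1 hw).2
    rw [mem_blowSet] at this
    exact ⟨this.1, fun i a => (mem_nb G _ _).1 (this.2 i a)⟩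
  obtain ⟨w0, hw0⟩ : Bz.Nonempty := Finset.card_pos.1 (by omega)
  obtain ⟨f⟩ : Nonempty (α ↪ Bz) := Function.Embedding.nonempty_of_card_le (by
    rw [Fintype.card_coe]; omega)
  obtain ⟨c⟩ := hH
  apply hG
  refine embed_copy H G z (hmem w0 hw0).1 (fun a => finSuccEquiv m (c a)) ?_ (fun a => (f a : V)) ?_ ?_ ?_
  · intro a b i ha hb hab
    exact c.valid hab ((finSuccEquiv m).injective (ha.trans hb.symm))
  · intro a b _ _ hab
    exact f.injective (Subtype.ext hab)
  · intro a b ha hb hab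
    exact absurd ((finSuccEquiv m).injective (ha.trans hb.symm)) (c.valid hab)
  · intro a _ i j
    exact (hmem (f a) (f a).2).2 i j

lemma class_degenerate {α : Type*} [Fintype α] (H : SimpleGraph α) (m : ℕ)
    (col : α → Option (Fin m))
    (hcol : ∀ a b i, col a = some i → col b = some i → ¬ H.Adj a b)
    (hF : ∀ T : Finset α, (∀ a ∈ T, col a = none) → T.Nonempty →
      ∃ a ∈ T, (T.filter (fun b => H.Adj a b)).card ≤ 1)
    {V : Type} [Fintype V] [Nonempty V] (G : SimpleGraph V)
    (hG : ¬ ContainsCopy H G) (ε : ℝ) (hε : 0 < ε) (L : ℕ) (hL : 2 * (Fintype.card α : ℝ) ≤ ε * L)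
    (W : Finset V)
    (hW : ∀ u ∈ W, ∀ v ∈ W, G.Adj u v → ε * (Fintype.card V : ℝ) ^ (m * Fintype.card α) ≤
      ((blowSet G m (Fintype.card α) (nb G u ∩ nb G v)).card : ℝ)) :
    ∀ T ⊆ W, T.Nonempty → ∃ v ∈ T, (T.filter (fun u => G.Adj v u)).card ≤ L := by
  intro T hT hTne
  set s := Fintype.card α with hs
  by_contra hcon
  push Not at hcon
  set N : ℝ := (Fintype.card V : ℝ) ^ (m * s) with hNdef
  have hN : 0 < N := by
    have : (0 : ℝ) < Fintype.card V := by exact_mod_cast Fintype.card_pos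
    positivity
  set Tz : (Fin m → Fin s → V) → Finset V :=
    fun z => T.filter (fun w => z ∈ blowSet G m s (nb G w)) with hTz
  have hsum : ∑ z, ∑ u ∈ Tz z, (((Tz z).filter (fun v => G.Adj u v)).card : ℝ) =
      ∑ u ∈ T, ∑ v ∈ T.filter (fun v => G.Adj u v), ((blowSet G m s (nb G u ∩ nb G v)).card : ℝ) := by
    have h1 : ∀ z, ∑ u ∈ Tz z, (((Tz z).filter (fun v => G.Adj u v)).card : ℝ) =
        ∑ u ∈ T, ∑ v ∈ T.filter (fun v => G.Adj u v),
          if z ∈ blowSet G m s (nb G u ∩ nb G v) then (1 : ℝ) else 0 := by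
      intro z
      rw [hTz, Finset.sum_filter]
      apply Finset.sum_congr rfl
      intro u _
      split_ifs with hu
      · rw [Finset.filter_filter, Finset.card_filter, Finset.sum_filter]
        push_cast
        apply Finset.sum_congr rfl
        intro v _
        rw [mem_blowSet] at hu
        simp only [mem_blowSet, Finset.mem_inter]
        by_cases huv : G.Adj u v
        · simp only [huv, and_true, if_true]
          congr 1
          apply propext
          constructor
          · rintro ⟨h1, h2⟩
            exact ⟨h1, fun i a => ⟨hu.2 i a, h2 i a⟩⟩
          · rintro ⟨h1, h2⟩
            exact ⟨h1, fun i a => (h2 i a).2⟩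
        · simp [huv]
      · symm
        apply Finset.sum_eq_zero
        intro v _
        rw [if_neg]
        intro h
        apply hu
        rw [mem_blowSet] at h ⊢
        exact ⟨h.1, fun i a => (Finset.mem_inter.1 (h.2 i a)).1⟩
    simp_rw [h1]
    rw [Finset.sum_comm]
    apply Finset.sum_congr rfl
    intro u _
    rw [Finset.sum_comm]
    simp
  have hlow : (∑ z : Fin m → Fin s → V, 2 * (s : ℝ) * T.card) <
      ∑ z, ∑ u ∈ Tz z, (((Tz z).filter (fun v => G.Adj u v)).card : ℝ) := by
    rw [hsum]
    have e1 : (∑ z : Fin m → Fin s → V, 2 * (s : ℝ) * T.card) = N * (2 * (s : ℝ) * T.card) := by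
      rw [Finset.sum_const, nsmul_eq_mul, Finset.card_univ]
      simp [← pow_mul, hNdef]
      rw [mul_comm s m]; simp
    rw [e1]
    calc N * (2 * (s : ℝ) * T.card) ≤ N * (ε * L * T.card) := by gcongr
      _ = ∑ u ∈ T, (L : ℝ) * (ε * N) := by rw [Finset.sum_const, nsmul_eq_mul]; ring
      _ < ∑ u ∈ T, ((T.filter (fun v => G.Adj u v)).card : ℝ) * (ε * N) := by
          apply Finset.sum_lt_sum_of_nonempty hTne
          intro u hu
          apply mul_lt_mul_of_pos_right _ (by positivity)
          exact_mod_cast hcon u hu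
      _ = ∑ u ∈ T, ∑ v ∈ T.filter (fun v => G.Adj u v), (ε * N) := by
          apply Finset.sum_congr rfl
          intro u _
          rw [Finset.sum_const, nsmul_eq_mul]
      _ ≤ _ := by
          apply Finset.sum_le_sum
          intro u hu
          apply Finset.sum_le_sum
          intro v hv
          rw [Finset.mem_filter] at hv
          exact hW u (hT hu) v (hT hv.1) hv.2
  obtain ⟨z, _, hz⟩ := Finset.exists_lt_of_sum_lt hlow
  have hz1 : 2 * s * T.card < ∑ u ∈ Tz z, ((Tz z).filter (fun v => G.Adj u v)).card := by
    exact_mod_cast hz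
  have hne : (Tz z).Nonempty := by
    rw [Finset.nonempty_iff_ne_empty]
    intro he
    rw [he] at hz1
    simp at hz1
  have hmem : ∀ w ∈ Tz z, IsBlow G z ∧ ∀ i a, G.Adj w (z i a) := by
    intro w hw
    have := (Finset.mem_filter.1 hw).2
    rw [mem_blowSet] at this
    exact ⟨this.1, fun i a => (mem_nb G _ _).1 (this.2 i a)⟩
  obtain ⟨W2, hW2, hW2ne, hdeg⟩ := exists_min_deg G s (Tz z) hne (by
    refine le_trans ?_ hz1.le
    exact Nat.mul_le_mul_left _ (Finset.card_le_card (Finset.filter_subset _ _)))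
  set F := Finset.univ.filter (fun a => col a = none) with hFdef
  have hFmem : ∀ a, a ∈ F ↔ col a = none := by intro a; simp [hFdef]
  obtain ⟨f, hf1, hf2, hf3⟩ := embed_forest H G F (fun T' hT' => hF T' (fun a ha => (hFmem a).1 (hT' ha)))
    W2 hW2ne hdeg F subset_rfl
  apply hG
  obtain ⟨w0, hw0⟩ := hne
  refine embed_copy H G z (hmem w0 hw0).1 col hcol f ?_ ?_ ?_
  · intro a b ha hb
    exact hf2 a ((hFmem a).2 ha) b ((hFmem b).2 hb)
  · intro a b ha hb
    exact hf3 a ((hFmem a).2 ha) b ((hFmem b).2 hb)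
  · intro a ha i j
    exact (hmem (f a) (hW2 (hf1 a ((hFmem a).2 ha)))).2 i j

lemma sec_moment {V : Type*} [Fintype V] (h : V → ℝ) (h0 : ∑ v, h v = 0) : ∀ L : ℕ,
    (∑ x : Fin L → V, (∑ i, h (x i)) ^ 2) * (Fintype.card V : ℝ) =
      L * (Fintype.card V : ℝ) ^ L * ∑ v, h v ^ 2 := by
  intro L
  induction L with
  | zero => simp
  | succ L ih =>
    rw [sum_insertNth 0]
    have h1 : ∀ a : V, ∑ y : Fin L → V, (∑ i, h ((Fin.insertNth 0 a y : Fin (L + 1) → V) i)) ^ 2 =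
        (Fintype.card V : ℝ) ^ L * h a ^ 2 + h a * (2 * ∑ y : Fin L → V, ∑ i, h (y i)) +
          ∑ y : Fin L → V, (∑ i, h (y i)) ^ 2 := by
      intro a
      have : ∀ y : Fin L → V, (∑ i, h ((Fin.insertNth 0 a y : Fin (L + 1) → V) i)) ^ 2 =
          h a ^ 2 + 2 * h a * (∑ i, h (y i)) + (∑ i, h (y i)) ^ 2 := by
        intro y
        rw [Fin.sum_univ_succAbove _ 0]
        simp only [Fin.insertNth_apply_same, Fin.insertNth_apply_succAbove]
        ring
      simp_rw [this, Finset.sum_add_distrib]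
      rw [← Finset.mul_sum, Finset.sum_const, nsmul_eq_mul, Finset.card_univ]
      simp
      ring
    simp_rw [h1, Finset.sum_add_distrib]
    rw [← Finset.mul_sum, ← Finset.sum_mul, h0, Finset.sum_const, nsmul_eq_mul, Finset.card_univ]
    simp only [zero_mul, add_zero]
    rw [add_mul, mul_assoc (Fintype.card V : ℝ), ih]
    push_cast
    ring

/-- average sampling deviation -/
lemma dev_bound {V : Type*} [Fintype V] [Nonempty V] (S : Finset V) (K : ℕ) :
    ∑ x : Fin (K * K) → V,
      |((Finset.univ.filter (fun i => x i ∈ S)).card : ℝ) - (K * K : ℕ) * (S.card / Fintype.card V : ℝ)|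
      ≤ K * (Fintype.card V : ℝ) ^ (K * K) := by
  have hn : (0 : ℝ) < Fintype.card V := by exact_mod_cast Fintype.card_pos
  set n : ℝ := (Fintype.card V : ℝ) with hnn
  set p : ℝ := S.card / n with hp
  have hp0 : 0 ≤ p := by positivity
  have hp1 : p ≤ 1 := by
    rw [hp, div_le_one hn]
    rw [hnn]
    exact_mod_cast Finset.card_le_univ S
  set h : V → ℝ := fun v => (if v ∈ S then 1 else 0) - p with hh
  have h0 : ∑ v, h v = 0 := by
    simp only [hh, Finset.sum_sub_distrib]
    rw [Finset.sum_const, nsmul_eq_mul, Finset.card_univ]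
    simp [hp, ← hnn]
    field_simp
    ring
  have hx : ∀ x : Fin (K * K) → V, ((Finset.univ.filter (fun i => x i ∈ S)).card : ℝ) -
      (K * K : ℕ) * p = ∑ i, h (x i) := by
    intro x
    simp only [hh, Finset.sum_sub_distrib]
    rw [Finset.sum_const, nsmul_eq_mul, Finset.card_univ]
    simp
  have hsq : ∑ v, h v ^ 2 ≤ n := by
    calc ∑ v, h v ^ 2 ≤ ∑ v : V, (1 : ℝ) := by
          apply Finset.sum_le_sum
          intro v _
          simp only [hh]
          split_ifs <;> nlinarith
      _ = n := by simp [hnn]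
  have hsm := sec_moment h h0 (K * K)
  simp_rw [hx]
  have hle : (∑ x : Fin (K * K) → V, (∑ i, h (x i)) ^ 2) ≤ (K * K : ℕ) * n ^ (K * K) := by
    have : (∑ x : Fin (K * K) → V, (∑ i, h (x i)) ^ 2) * n ≤ ((K * K : ℕ) * n ^ (K * K)) * n := by
      rw [hsm]
      gcongr
    exact le_of_mul_le_mul_right this hn
  have hcs := @sq_sum_le_card_mul_sum_sq (Fin (K * K) → V) ℝ _ _ _ _ Finset.univ (fun x => |∑ i, h (x i)|)
  simp only [sq_abs, Finset.card_univ] at hcs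
  have hc : (Fintype.card (Fin (K * K) → V) : ℝ) = n ^ (K * K) := by simp [hnn]
  rw [hc] at hcs
  apply le_of_sq_le_sq _ (by positivity)
  calc _ ≤ n ^ (K * K) * ((K * K : ℕ) * n ^ (K * K)) := hcs.trans (by gcongr)
    _ = _ := by push_cast; ring

lemma types_lemma (τ : ℝ) (hτ : 0 < τ) : ∃ M : ℕ, ∀ (V Y : Type) [Fintype V] [Fintype Y] [Nonempty V]
    [Nonempty Y] (A : Y → Finset V) (P : V → Finset V), ∃ cls : V → Fin M, ∀ u v, cls u = cls v →
    ∑ y, |((P u ∩ A y).card : ℝ) - (P v ∩ A y).card| ≤ τ * Fintype.card V * Fintype.card Y := by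
  obtain ⟨K, hK⟩ := exists_nat_gt (8 / τ)
  have hK0 : (0 : ℝ) < K := lt_trans (by positivity) hK
  have hKτ : 8 < K * τ := by rwa [div_lt_iff₀ hτ] at hK
  refine ⟨2 ^ (K * K + 1), ?_⟩
  intro V Y _ _ _ _ A P
  set n : ℝ := (Fintype.card V : ℝ) with hnn
  set q : ℝ := (Fintype.card Y : ℝ) with hq
  have hn : (0 : ℝ) < n := by rw [hnn]; exact_mod_cast Fintype.card_pos
  have hq0 : (0 : ℝ) < q := by rw [hq]; exact_mod_cast Fintype.card_pos
  set D : V → V → ℝ := fun u v => ∑ y, |((P u ∩ A y).card : ℝ) - (P v ∩ A y).card| with hD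
  have Dsymm : ∀ u v, D u v = D v u := by
    intro u v; simp only [hD]; exact Finset.sum_congr rfl (fun y _ => abs_sub_comm _ _)
  have Dtri : ∀ u v w, D u w ≤ D u v + D v w := by
    intro u v w
    simp only [hD]
    rw [← Finset.sum_add_distrib]
    exact Finset.sum_le_sum (fun y _ => abs_sub_le _ _ _)
  have D0 : ∀ u, D u u = 0 := by intro u; simp [hD]
  let good : Finset V → Prop := fun U => ∀ u ∈ U, ∀ v ∈ U, u ≠ v → τ / 2 * n * q < D u v
  -- bound
  have hbound : ∀ U, good U → U.card ≤ 2 ^ (K * K + 1) := by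
    intro U hU
    by_contra hcon
    push Not at hcon
    let dev : (Fin (K * K) → V) → Finset V → ℝ := fun x S =>
      |((Finset.univ.filter (fun i => x i ∈ S)).card : ℝ) - (K * K : ℕ) * (S.card / n : ℝ)|
    have hx : ∃ x ∈ (Finset.univ : Finset (Fin (K * K) → V)), ∑ u ∈ U, ∑ y, dev x (P u ∩ A y) ≤ U.card * q * K := by
      apply Finset.exists_le_of_sum_le Finset.univ_nonempty
      rw [Finset.sum_comm]
      calc ∑ u ∈ U, ∑ x, ∑ y, dev x (P u ∩ A y) ≤ ∑ u ∈ U, ∑ y : Y, K * n ^ (K * K) := by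
            apply Finset.sum_le_sum
            intro u _
            rw [Finset.sum_comm]
            apply Finset.sum_le_sum
            intro y _
            exact dev_bound (P u ∩ A y) K
        _ = _ := by
            simp [hnn, hq]
            ring
    obtain ⟨x, _, hx⟩ := hx
    set e : V → ℝ := fun u => ∑ y, dev x (P u ∩ A y) with he
    have he0 : ∀ u, 0 ≤ e u := fun u => Finset.sum_nonneg (fun y _ => abs_nonneg _)
    set Good := U.filter (fun u => e u ≤ 2 * q * K) with hGood
    have hcard : 2 ^ (K * K) < Good.card := by
      have h1 : ((U.filter (fun u => ¬ e u ≤ 2 * q * K)).card : ℝ) * (2 * q * K) ≤ U.card * q * K := by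
        calc _ = ∑ u ∈ U.filter (fun u => ¬ e u ≤ 2 * q * K), (2 * q * K) := by
              rw [Finset.sum_const, nsmul_eq_mul]
          _ ≤ ∑ u ∈ U.filter (fun u => ¬ e u ≤ 2 * q * K), e u := by
              apply Finset.sum_le_sum
              intro u hu
              exact le_of_lt (not_le.1 (Finset.mem_filter.1 hu).2)
          _ ≤ ∑ u ∈ U, e u := Finset.sum_le_sum_of_subset_of_nonneg (Finset.filter_subset _ _)
              (fun u _ _ => he0 u)
          _ ≤ _ := hx
      have h2 : 2 * ((U.filter (fun u => ¬ e u ≤ 2 * q * K)).card : ℝ) ≤ U.card := by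
        have hqK : 0 < q * K := by positivity
        apply le_of_mul_le_mul_right _ hqK
        linarith
      have h3 := Finset.card_filter_add_card_filter_not (s := U) (fun u => e u ≤ 2 * q * K)
      have h4 : 2 * (U.filter (fun u => ¬ e u ≤ 2 * q * K)).card ≤ U.card := by exact_mod_cast h2
      rw [pow_succ] at hcon
      rw [← hGood] at h3
      omega
    have hpig := Finset.exists_ne_map_eq_of_card_lt_of_maps_to (s := Good)
      (t := (Finset.univ : Finset (Finset (Fin (K * K))))) (by simpa using hcard)
      (f := fun u => Finset.univ.filter (fun i => x i ∈ P u)) (fun _ _ => by simp)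
    obtain ⟨u, hu, v, hv, huv, htr⟩ := hpig
    have hu' := Finset.mem_filter.1 hu
    have hv' := Finset.mem_filter.1 hv
    have hlow := hU u hu'.1 v hv'.1 huv
    have hup : (K * K : ℕ) * D u v / n ≤ e u + e v := by
      simp only [he, hD]
      rw [← Finset.sum_add_distrib, Finset.mul_sum, Finset.sum_div]
      apply Finset.sum_le_sum
      intro y _
      have hsame : Finset.univ.filter (fun i => x i ∈ P u ∩ A y) = Finset.univ.filter (fun i => x i ∈ P v ∩ A y) := by
        ext i
        have := Finset.ext_iff.1 htr i
        simp at this ⊢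
        intro _
        exact this
      simp only [dev]
      rw [hsame]
      have h1 : ((K * K : ℕ) : ℝ) * |((P u ∩ A y).card : ℝ) - (P v ∩ A y).card| / n =
          |((K * K : ℕ) : ℝ) * ((P u ∩ A y).card / n) - ((K * K : ℕ) : ℝ) * ((P v ∩ A y).card / n)| := by
        rw [← mul_sub, ← sub_div, abs_mul, abs_div, abs_of_pos hn, abs_of_nonneg (Nat.cast_nonneg (K * K) : (0 : ℝ) ≤ _)]
        ring
      rw [h1]
      set a := ((K * K : ℕ) : ℝ) * ((P u ∩ A y).card / n)
      set b := ((K * K : ℕ) : ℝ) * ((P v ∩ A y).card / n)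
      set c : ℝ := ((Finset.univ.filter (fun i => x i ∈ P v ∩ A y)).card : ℝ)
      have := abs_sub_le a c b
      rw [abs_sub_comm a c] at this
      exact this
    have h5 : (K * K : ℕ) * D u v / n ≤ 4 * q * K := by linarith [hu'.2, hv'.2]
    rw [div_le_iff₀ hn] at h5
    push_cast at h5
    have h6 : K * D u v ≤ 4 * q * n := by
      apply le_of_mul_le_mul_left _ hK0
      linarith
    have h7 : K * (τ / 2 * n * q) < K * D u v := mul_lt_mul_of_pos_left hlow hK0
    have h8 : 0 < n * q := by positivity
    nlinarith
  -- maximal U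
  obtain ⟨U, hUg, hUmax⟩ : ∃ U, good U ∧ ∀ U', good U' → U'.card ≤ U.card := by
    have hne : ((Finset.univ : Finset (Finset V)).filter good).Nonempty := ⟨∅, by simp [good]⟩
    obtain ⟨U, hU, hmax⟩ := Finset.exists_max_image _ Finset.card hne
    refine ⟨U, (Finset.mem_filter.1 hU).2, fun U' hU' => hmax U' (by simp [hU'])⟩
  have hrep : ∀ u, ∃ w : U, D u w ≤ τ / 2 * n * q := by
    intro u
    by_contra hcon
    push Not at hcon
    have hnot : u ∉ U := by
      intro hu
      have := hcon ⟨u, hu⟩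
      rw [D0] at this
      have : 0 ≤ τ / 2 * n * q := by positivity
      linarith
    have := hUmax (insert u U) (by
      intro a ha b hb hab
      rw [Finset.mem_insert] at ha hb
      rcases ha with rfl | ha <;> rcases hb with rfl | hb
      · exact absurd rfl hab
      · exact hcon ⟨b, hb⟩
      · rw [Dsymm]; exact hcon ⟨a, ha⟩
      · exact hUg a ha b hb hab)
    rw [Finset.card_insert_of_notMem hnot] at this
    omega
  choose rep hrep using hrep
  obtain ⟨f⟩ : Nonempty (U ↪ Fin (2 ^ (K * K + 1))) := Function.Embedding.nonempty_of_card_le (by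
    rw [Fintype.card_coe, Fintype.card_fin]; exact hbound U hUg)
  refine ⟨fun u => f (rep u), fun u v huv => ?_⟩
  have huv' := f.injective huv
  have h1 := Dtri u (rep u) v
  have h2 := hrep u
  have h3 := hrep v
  rw [Dsymm, ← huv'] at h3
  change D u v ≤ _
  linarith
/-- extension set of a tuple -/
noncomputable def extSet {V : Type*} [Fintype V] (G : SimpleGraph V) {m : ℕ} (y : Fin m → V) : Finset V :=
  Finset.univ.filter (fun x => Clq G y ∧ ∀ i, G.Adj x (y i))

lemma mixed_split {V : Type*} [Fintype V] (G : SimpleGraph V) (m : ℕ) (S : Fin (m + 1) → Finset V)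
    (i : Fin (m + 1)) :
    ((Finset.univ.filter (fun x : Fin (m + 1) → V => Clq G x ∧ ∀ j, x j ∈ S j)).card : ℝ) =
      ∑ y : Fin m → V, if (∀ j, y j ∈ S (i.succAbove j)) then ((S i ∩ extSet G y).card : ℝ) else 0 := by
  rw [Finset.card_filter]
  push_cast
  rw [sum_insertNth i, Finset.sum_comm]
  apply Finset.sum_congr rfl
  intro y _
  split_ifs with h
  · rw [Finset.card_eq_sum_ones, ← Finset.filter_mem_eq_inter, Finset.sum_filter]
    push_cast
    rw [← Finset.sum_filter, ← Finset.sum_filter]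
    apply Finset.sum_congr _ (fun _ _ => rfl)
    ext a
    simp only [Finset.mem_filter, Finset.mem_univ, true_and, extSet, clq_insertNth,
      Fin.forall_iff_succAbove i, Fin.insertNth_apply_same, Fin.insertNth_apply_succAbove]
    tauto
  · apply Finset.sum_eq_zero
    intro a _
    rw [if_neg]
    rintro ⟨_, h2⟩
    apply h
    intro j
    simpa using h2 (i.succAbove j)

lemma swap_lemma {V : Type*} [Fintype V] (G : SimpleGraph V) (m : ℕ) (P P' : Finset V) (T : ℝ)
    (hT : 0 ≤ T)
    (hD : ∑ y : Fin m → V, |((P ∩ extSet G y).card : ℝ) - (P' ∩ extSet G y).card| ≤ T) :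
    (cliqCount G (m + 1) (P ∪ P') : ℝ) ≤ 2 ^ (m + 1) * cliqCount G (m + 1) P + (m + 1) * 2 ^ (m + 1) * T := by
  let K : Finset (Fin (m + 1)) → ℝ := fun I =>
    ((Finset.univ.filter (fun x : Fin (m + 1) → V => Clq G x ∧ ∀ j, x j ∈ if j ∈ I then P' else P)).card : ℝ)
  have hstep : ∀ I i, i ∉ I → K (insert i I) ≤ K I + T := by
    intro I i hi
    simp only [K]
    rw [mixed_split G m _ i, mixed_split G m _ i]
    refine le_trans ?_ (add_le_add_right hD _)
    rw [← Finset.sum_add_distrib]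
    apply Finset.sum_le_sum
    intro y _
    have hc : (∀ j, y j ∈ if i.succAbove j ∈ insert i I then P' else P) ↔
        (∀ j, y j ∈ if i.succAbove j ∈ I then P' else P) := by
      apply forall_congr'
      intro j
      have : i.succAbove j ∈ insert i I ↔ i.succAbove j ∈ I := by
        rw [Finset.mem_insert]
        have := Fin.succAbove_ne i j
        tauto
      simp only [this]
    simp only [hc, hi, Finset.mem_insert_self, if_true, if_false]
    split_ifs
    · have := neg_abs_le (((P ∩ extSet G y).card : ℝ) - (P' ∩ extSet G y).card)
      linarith
    · simp
  have hK : ∀ I, K I ≤ K ∅ + I.card * T := by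
    intro I
    induction I using Finset.induction_on with
    | empty => simp
    | insert i I hi ih =>
      rw [Finset.card_insert_of_notMem hi]
      push_cast
      linarith [hstep I i hi]
  have hK0 : K ∅ = cliqCount G (m + 1) P := by simp [K, cliqCount]
  have hcover : (cliqCount G (m + 1) (P ∪ P') : ℝ) ≤ ∑ I : Finset (Fin (m + 1)), K I := by
    simp only [K, cliqCount]
    rw [← Nat.cast_sum]
    norm_cast
    refine le_trans (Finset.card_le_card ?_) (Finset.card_biUnion_le)
    intro x hx
    simp only [Finset.mem_filter, Finset.mem_univ, true_and, Finset.mem_union, Finset.mem_biUnion] at hx ⊢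
    refine ⟨Finset.univ.filter (fun j => x j ∉ P), hx.1, fun j => ?_⟩
    by_cases hj : x j ∈ P
    · simp [hj]
    · have := hx.2 j
      simp [hj] at this ⊢
      exact this
  refine hcover.trans ?_
  calc ∑ I : Finset (Fin (m + 1)), K I ≤ ∑ I : Finset (Fin (m + 1)), (K ∅ + (m + 1) * T) := by
        apply Finset.sum_le_sum
        intro I _
        refine (hK I).trans ?_
        have : (I.card : ℝ) ≤ m + 1 := by
          have := Finset.card_le_univ I
          rw [Fintype.card_fin] at this
          exact_mod_cast this
        nlinarith
    _ = _ := by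
        rw [Finset.sum_const, nsmul_eq_mul, hK0]
        simp
        ring
/-- dense pairs (vertex set, index set) -/
noncomputable def badSet {N M : ℕ} (t : ℕ) (f : Fin M → Fin N × Fin N) :
    Finset (Finset (Fin N) × Finset (Fin M)) :=
  Finset.univ.filter (fun p => (p.1.card = p.2.card ∧ 1 ≤ p.2.card ∧ p.2.card ≤ t) ∧
    ∀ j ∈ p.2, (f j).1 ∈ p.1 ∧ (f j).2 ∈ p.1)

lemma card_inside {N M : ℕ} (T : Finset (Fin N)) (J : Finset (Fin M)) :
    (Finset.univ.filter (fun f : Fin M → Fin N × Fin N => ∀ j ∈ J, (f j).1 ∈ T ∧ (f j).2 ∈ T)).card =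
      (T.card * T.card) ^ J.card * (N * N) ^ (M - J.card) := by
  have : (Finset.univ.filter (fun f : Fin M → Fin N × Fin N => ∀ j ∈ J, (f j).1 ∈ T ∧ (f j).2 ∈ T)) =
      Fintype.piFinset (fun j => if j ∈ J then T ×ˢ T else Finset.univ) := by
    ext f
    simp only [Finset.mem_filter, Finset.mem_univ, true_and, Fintype.mem_piFinset]
    apply forall_congr'
    intro j
    split_ifs with h <;> simp [h]
  rw [this, Fintype.card_piFinset]
  have : ∀ j, (if j ∈ J then T ×ˢ T else Finset.univ : Finset (Fin N × Fin N)).card =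
      if j ∈ J then T.card * T.card else N * N := by
    intro j
    split_ifs <;> simp
  simp_rw [this]
  rw [Finset.prod_ite, Finset.prod_const, Finset.prod_const, Finset.filter_mem_eq_inter, Finset.univ_inter,
    Finset.filter_not, Finset.filter_mem_eq_inter, Finset.univ_inter, ← Finset.compl_eq_univ_sdiff,
    Finset.card_compl, Fintype.card_fin]

lemma sum_bad (N d t : ℕ) :
    ∑ f : Fin (d * N) → Fin N × Fin N, (badSet t f).card ≤
      (∑ l ∈ Finset.Icc 1 t, (d * (l * l)) ^ l) * (N * N) ^ (d * N) := by
  set M := d * N with hM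
  have h1 : ∑ f : Fin M → Fin N × Fin N, (badSet t f).card =
      ∑ p ∈ (Finset.univ.filter (fun p : Finset (Fin N) × Finset (Fin M) =>
        p.1.card = p.2.card ∧ 1 ≤ p.2.card ∧ p.2.card ≤ t)),
        (p.1.card * p.1.card) ^ p.2.card * (N * N) ^ (M - p.2.card) := by
    simp_rw [← card_inside, badSet, Finset.card_filter]
    rw [Finset.sum_comm, Finset.sum_filter]
    apply Finset.sum_congr rfl
    intro p _
    split_ifs with h
    · simp [h]
    · simp only [h, false_and, if_false, Finset.sum_const_zero]
  rw [h1, Finset.sum_mul]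
  rw [← Finset.sum_fiberwise_of_maps_to (t := Finset.Icc 1 t) (g := fun p => p.2.card)
    (fun p hp => by simp at hp; simp [hp])]
  apply Finset.sum_le_sum
  intro l hl
  have h2 : ∀ p ∈ (Finset.univ.filter (fun p : Finset (Fin N) × Finset (Fin M) =>
        p.1.card = p.2.card ∧ 1 ≤ p.2.card ∧ p.2.card ≤ t)).filter (fun p => p.2.card = l),
        (p.1.card * p.1.card) ^ p.2.card * (N * N) ^ (M - p.2.card) = (l * l) ^ l * (N * N) ^ (M - l) := by
    intro p hp
    simp at hp
    rw [hp.1.1, hp.2]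
  rw [Finset.sum_congr rfl h2, Finset.sum_const, smul_eq_mul]
  have h3 : ((Finset.univ.filter (fun p : Finset (Fin N) × Finset (Fin M) =>
        p.1.card = p.2.card ∧ 1 ≤ p.2.card ∧ p.2.card ≤ t)).filter (fun p => p.2.card = l)).card ≤
        N.choose l * M.choose l := by
    calc _ ≤ (Finset.powersetCard l (Finset.univ : Finset (Fin N)) ×ˢ
          Finset.powersetCard l (Finset.univ : Finset (Fin M))).card := by
          apply Finset.card_le_card
          intro p hp
          simp at hp ⊢
          omega
      _ = _ := by simp
  refine (Nat.mul_le_mul_right _ h3).trans ?_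
  by_cases hlM : l ≤ M
  · have h4 : N.choose l * M.choose l ≤ N ^ l * M ^ l :=
      Nat.mul_le_mul (Nat.choose_le_pow N l) (Nat.choose_le_pow M l)
    refine (Nat.mul_le_mul_right _ h4).trans (le_of_eq ?_)
    have h5 : (N * N) ^ M = (N * N) ^ l * (N * N) ^ (M - l) := by
      rw [← pow_add]; congr 1; omega
    rw [h5]
    simp only [hM, mul_pow]
    ring
  · rw [Nat.choose_eq_zero_of_lt (not_le.1 hlM)]
    simp

/-- number of monochromatic non-loop indices -/
noncomputable def monoCount {N M C : ℕ} (φ : Fin N → Fin C) (f : Fin M → Fin N × Fin N) : ℕ :=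
  (Finset.univ.filter (fun j => (f j).1 ≠ (f j).2 ∧ φ (f j).1 = φ (f j).2)).card

lemma mono_pairs {N C : ℕ} (hC : 1 ≤ C) (hN : 2 * C ≤ N) (φ : Fin N → Fin C) :
    (N : ℝ) * N / (2 * C) ≤
      ((Finset.univ.filter (fun e : Fin N × Fin N => e.1 ≠ e.2 ∧ φ e.1 = φ e.2)).card : ℝ) := by
  have hC' : (0 : ℝ) < C := by exact_mod_cast hC
  have hN' : (2 : ℝ) * C ≤ N := by exact_mod_cast hN
  have h1 : ((Finset.univ.filter (fun e : Fin N × Fin N => φ e.1 = φ e.2)).card : ℝ) =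
      ∑ c : Fin C, ((Finset.univ.filter (fun v => φ v = c)).card : ℝ) ^ 2 := by
    rw [Finset.card_eq_sum_card_fiberwise (t := Finset.univ) (f := fun e => φ e.1) (by simp)]
    push_cast
    apply Finset.sum_congr rfl
    intro c _
    rw [sq, ← Nat.cast_mul, ← Finset.card_product]
    congr 2
    ext e
    simp
    constructor
    · rintro ⟨h, rfl⟩; exact ⟨rfl, h.symm⟩
    · rintro ⟨h, h'⟩; exact ⟨h.trans h'.symm, h⟩
  have h2 : (∑ c : Fin C, ((Finset.univ.filter (fun v => φ v = c)).card : ℝ)) = N := by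
    rw [← Nat.cast_sum, ← Finset.card_eq_sum_card_fiberwise (by simp)]
    simp
  have h3 := @sq_sum_le_card_mul_sum_sq (Fin C) ℝ _ _ _ _ Finset.univ
    (fun c => ((Finset.univ.filter (fun v => φ v = c)).card : ℝ))
  rw [h2, ← h1, Finset.card_univ, Fintype.card_fin] at h3
  have h4 : ((Finset.univ.filter (fun e : Fin N × Fin N => φ e.1 = φ e.2)).card) ≤
      (Finset.univ.filter (fun e : Fin N × Fin N => e.1 ≠ e.2 ∧ φ e.1 = φ e.2)).card + N := by
    calc _ ≤ ((Finset.univ.filter (fun e : Fin N × Fin N => e.1 ≠ e.2 ∧ φ e.1 = φ e.2)) ∪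
          (Finset.univ.image (fun v : Fin N => (v, v)))).card := by
          apply Finset.card_le_card
          rintro ⟨a, b⟩ he
          simp at he ⊢
          by_cases hab : a = b
          · right; exact hab
          · left; exact ⟨hab, he⟩
      _ ≤ _ := (Finset.card_union_le _ _).trans (Nat.add_le_add_left
          (Finset.card_image_le.trans (by simp)) _)
  have h4' : ((Finset.univ.filter (fun e : Fin N × Fin N => φ e.1 = φ e.2)).card : ℝ) ≤
      (Finset.univ.filter (fun e : Fin N × Fin N => e.1 ≠ e.2 ∧ φ e.1 = φ e.2)).card + N := by
    exact_mod_cast h4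
  rw [div_le_iff₀ (by positivity)]
  nlinarith

lemma sum_mono {N C M : ℕ} (hC : 1 ≤ C) (hN : 2 * C ≤ N) (φ : Fin N → Fin C) :
    ∑ f : Fin M → Fin N × Fin N, (1 / 2 : ℝ) ^ (monoCount φ f) ≤
      ((N : ℝ) * N * (1 - 1 / (4 * C))) ^ M := by
  have hC' : (0 : ℝ) < C := by exact_mod_cast hC
  set w : Fin N × Fin N → ℝ := fun e => if e.1 ≠ e.2 ∧ φ e.1 = φ e.2 then 1 / 2 else 1 with hw
  have h1 : ∀ f : Fin M → Fin N × Fin N, (1 / 2 : ℝ) ^ (monoCount φ f) = ∏ j, w (f j) := by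
    intro f
    simp only [hw, monoCount]
    rw [Finset.prod_ite, Finset.prod_const, Finset.prod_const, one_pow, mul_one]
  simp_rw [h1]
  rw [← Fintype.sum_pow]
  have h2 : ∑ e, w e = (N : ℝ) * N -
      ((Finset.univ.filter (fun e : Fin N × Fin N => e.1 ≠ e.2 ∧ φ e.1 = φ e.2)).card : ℝ) / 2 := by
    have : ∀ e, w e = 1 - (if e.1 ≠ e.2 ∧ φ e.1 = φ e.2 then (1 : ℝ) else 0) / 2 := by
      intro e
      simp only [hw]
      split_ifs <;> norm_num
    simp_rw [this]
    rw [Finset.sum_sub_distrib, ← Finset.sum_div]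
    simp
  apply pow_le_pow_left₀
  · apply Finset.sum_nonneg
    intro e _
    simp only [hw]
    split_ifs <;> norm_num
  · rw [h2]
    have := mono_pairs hC hN φ
    have h5 : (N : ℝ) * N * (1 - 1 / (4 * C)) = N * N - (N * N / (2 * C)) / 2 := by
      field_simp; ring
    rw [h5]
    linarith

lemma exists_good_f (C t : ℕ) (hC : 1 ≤ C) : ∃ (N M K : ℕ) (f : Fin M → Fin N × Fin N),
    (badSet t f).card < 2 * K ∧ ∀ φ : Fin N → Fin C, 2 * K < monoCount φ f := by
  have hC' : (0 : ℝ) < C := by exact_mod_cast hC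
  have hC1 : (1 : ℝ) ≤ C := by exact_mod_cast hC
  have hq0 : (0 : ℝ) ≤ 1 - 1 / (4 * C) := by
    rw [sub_nonneg, div_le_one (by positivity)]; linarith
  obtain ⟨d, hd⟩ := exists_pow_lt_of_lt_one (show (0 : ℝ) < 1 / (2 * C) by positivity)
    (show (1 : ℝ) - 1 / (4 * C) < 1 by
      have : (0 : ℝ) < 1 / (4 * C) := by positivity
      linarith)
  set K := 1 + ∑ l ∈ Finset.Icc 1 t, (d * (l * l)) ^ l with hK
  set N := 2 * K + 2 + 2 * C with hN
  set M := d * N with hM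
  refine ⟨N, M, K, ?_⟩
  have hK1 : (1 : ℝ) ≤ K := by
    have : 1 ≤ K := by omega
    exact_mod_cast this
  set W : ℝ := ((N : ℝ) * N) ^ M with hW
  have hN0 : (0 : ℝ) < N := by
    have : 0 < N := by omega
    exact_mod_cast this
  have hW0 : 0 < W := by positivity
  have hbad : ∑ f : Fin M → Fin N × Fin N, ((badSet t f).card : ℝ) ≤ K * W := by
    have h1 := sum_bad N d t
    have h2 : ∑ f : Fin M → Fin N × Fin N, (badSet t f).card ≤ K * (N * N) ^ M := by
      refine h1.trans (Nat.mul_le_mul_right _ ?_)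
      omega
    rw [hW]
    exact_mod_cast h2
  have hmono : ∀ φ : Fin N → Fin C, ∑ f : Fin M → Fin N × Fin N, (1 / 2 : ℝ) ^ (monoCount φ f) ≤
      W * (1 / (2 * C)) ^ N := by
    intro φ
    refine (sum_mono hC (by omega) φ).trans ?_
    rw [mul_pow, ← hW, hM, pow_mul]
    gcongr
  have htot : ∑ f : Fin M → Fin N × Fin N, (((badSet t f).card : ℝ) / (2 * K) +
      ∑ φ : Fin N → Fin C, 2 ^ (2 * K) * (1 / 2 : ℝ) ^ (monoCount φ f)) <
      ∑ f : Fin M → Fin N × Fin N, (1 : ℝ) := by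
    have hcard : ∑ f : Fin M → Fin N × Fin N, (1 : ℝ) = W := by
      simp [hW]
    rw [hcard, Finset.sum_add_distrib, Finset.sum_comm, ← Finset.sum_div]
    have h1 : (∑ f : Fin M → Fin N × Fin N, ((badSet t f).card : ℝ)) / (2 * K) ≤ W / 2 := by
      rw [div_le_iff₀ (by positivity)]
      linarith
    have h2 : ∑ φ : Fin N → Fin C, ∑ f : Fin M → Fin N × Fin N, 2 ^ (2 * K) * (1 / 2 : ℝ) ^ (monoCount φ f) ≤
        W * (1 / 4) := by
      calc _ ≤ ∑ φ : Fin N → Fin C, 2 ^ (2 * K) * (W * (1 / (2 * C : ℝ)) ^ N) := by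
            apply Finset.sum_le_sum
            intro φ _
            rw [← Finset.mul_sum]
            have := hmono φ
            gcongr
        _ = W * (2 ^ (2 * K) * ((C : ℝ) ^ N * (1 / (2 * C : ℝ)) ^ N)) := by
            rw [Finset.sum_const, nsmul_eq_mul, Finset.card_univ]
            simp only [Fintype.card_fun, Fintype.card_fin, Nat.cast_pow]
            ring
        _ = W * (2 ^ (2 * K) * (1 / 2 : ℝ) ^ N) := by
            rw [← mul_pow, show (C : ℝ) * (1 / (2 * C : ℝ)) = 1 / 2 by field_simp]
        _ ≤ W * (2 ^ (2 * K) * (1 / 2 : ℝ) ^ (2 * K + 2)) := by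
            have : (1 / 2 : ℝ) ^ N ≤ (1 / 2 : ℝ) ^ (2 * K + 2) :=
              pow_le_pow_of_le_one (by norm_num) (by norm_num) (by omega)
            gcongr
        _ = W * (1 / 4) := by
            rw [pow_add, ← mul_assoc (2 ^ (2 * K)), ← mul_pow]
            norm_num
    linarith
  obtain ⟨f, _, hf⟩ := Finset.exists_lt_of_sum_lt htot
  refine ⟨f, ?_, ?_⟩
  · have h1 : 0 ≤ ∑ φ : Fin N → Fin C, 2 ^ (2 * K) * (1 / 2 : ℝ) ^ (monoCount φ f) :=
      Finset.sum_nonneg (fun φ _ => by positivity)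
    have h2 : ((badSet t f).card : ℝ) / (2 * K) < 1 := by linarith
    rw [div_lt_one (by positivity)] at h2
    exact_mod_cast h2
  · intro φ
    by_contra hcon
    push Not at hcon
    have h1 : 0 ≤ ((badSet t f).card : ℝ) / (2 * K) := by positivity
    have h2 := Finset.single_le_sum (f := fun φ : Fin N → Fin C => 2 ^ (2 * K) * (1 / 2 : ℝ) ^ (monoCount φ f))
      (fun φ _ => by positivity) (Finset.mem_univ φ)
    have h3 : (1 / 2 : ℝ) ^ (2 * K) ≤ (1 / 2 : ℝ) ^ (monoCount φ f) :=
      pow_le_pow_of_le_one (by norm_num) (by norm_num) hcon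
    have h4 : (2 : ℝ) ^ (2 * K) * (1 / 2 : ℝ) ^ (2 * K) = 1 := by
      rw [← mul_pow]; norm_num
    have h5 : (2 : ℝ) ^ (2 * K) * (1 / 2 : ℝ) ^ (2 * K) ≤ 2 ^ (2 * K) * (1 / 2 : ℝ) ^ (monoCount φ f) := by
      gcongr
    linarith

lemma high_girth (C t : ℕ) (hC : 1 ≤ C) : ∃ (N : ℕ) (Γ : SimpleGraph (Fin N)), ¬ Γ.Colorable C ∧
    ∀ T : Finset (Fin N), T.Nonempty → T.card ≤ t →
      ∃ v ∈ T, (T.filter (fun u => Γ.Adj v u)).card ≤ 1 := by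
  obtain ⟨N, M, K, f, hbad, hmono⟩ := exists_good_f C t hC
  have hsel : ∀ p : badSet t f, ∃ j, j ∈ p.1.2 := by
    rintro ⟨p, hp⟩
    simp only [badSet, Finset.mem_filter] at hp
    exact Finset.card_pos.1 hp.2.1.2.1
  choose sel hsel using hsel
  set D : Finset (Fin M) := Finset.univ.image sel with hD
  have hDc : D.card < 2 * K := by
    refine lt_of_le_of_lt Finset.card_image_le ?_
    simpa using hbad
  let Γ : SimpleGraph (Fin N) :=
    { Adj := fun a b => a ≠ b ∧ ∃ j, j ∉ D ∧ (f j = (a, b) ∨ f j = (b, a))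
      symm := ⟨by
        rintro a b ⟨h, j, hj, h'⟩
        exact ⟨h.symm, j, hj, h'.symm⟩⟩
      loopless := ⟨fun a h => h.1 rfl⟩ }
  refine ⟨N, Γ, ?_, ?_⟩
  · rintro ⟨c⟩
    have h1 := hmono (fun v => c v)
    have h2 : monoCount (fun v => c v) f ≤ D.card := by
      apply Finset.card_le_card
      intro j hj
      simp only [Finset.mem_filter, Finset.mem_univ, true_and] at hj
      by_contra hjD
      exact c.valid (show Γ.Adj (f j).1 (f j).2 from ⟨hj.1, j, hjD, Or.inl rfl⟩) hj.2
    omega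
  · intro T hT hTt
    by_contra hcon
    push Not at hcon
    set J' := Finset.univ.filter (fun j => j ∉ D ∧ (f j).1 ∈ T ∧ (f j).2 ∈ T) with hJ'
    set Pr := (T ×ˢ T).filter (fun e => Γ.Adj e.1 e.2) with hPr
    have h1 : 2 * T.card ≤ Pr.card := by
      have : Pr.card = ∑ v ∈ T, (T.filter (fun u => Γ.Adj v u)).card := by
        rw [hPr, Finset.card_filter, Finset.sum_product]
        apply Finset.sum_congr rfl
        intro v _
        rw [Finset.card_filter]
      rw [this, mul_comm, ← smul_eq_mul, ← Finset.sum_const]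
      refine Finset.sum_le_sum (fun v hv => ?_)
      refine (Nat.succ_le_of_lt (hcon v hv)).trans (le_of_eq ?_)
      congr!
    have h2 : Pr.card ≤ 2 * J'.card := by
      have : Pr ⊆ J'.image f ∪ J'.image (fun j => (f j).swap) := by
        rintro ⟨a, b⟩ he
        simp only [hPr, Finset.mem_filter, Finset.mem_product] at he
        obtain ⟨⟨ha, hb⟩, hab, j, hj, h | h⟩ := he
        · apply Finset.mem_union_left
          exact Finset.mem_image.2 ⟨j, by simp [hJ', hj, h, ha, hb], h⟩
        · apply Finset.mem_union_right
          exact Finset.mem_image.2 ⟨j, by simp [hJ', hj, h, ha, hb], by rw [h]; rfl⟩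
      have h3 := (Finset.card_le_card this).trans (Finset.card_union_le _ _)
      have h4 := Finset.card_image_le (s := J') (f := f)
      have h5 := Finset.card_image_le (s := J') (f := fun j => (f j).swap)
      omega
    obtain ⟨J, hJs, hJc⟩ := Finset.exists_subset_card_eq (show T.card ≤ J'.card by omega)
    have hmem : (T, J) ∈ badSet t f := by
      simp only [badSet, Finset.mem_filter, Finset.mem_univ, true_and]
      refine ⟨⟨hJc.symm, ?_, by omega⟩, ?_⟩
      · rw [hJc]; exact Finset.card_pos.2 hT
      · intro j hj
        have := hJs hj
        simp only [hJ', Finset.mem_filter] at this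
        exact this.2.2
    have h6 := hJs (hsel ⟨(T, J), hmem⟩)
    simp only [hJ', Finset.mem_filter] at h6
    exact h6.2.1 (Finset.mem_image.2 ⟨⟨(T, J), hmem⟩, Finset.mem_univ _, rfl⟩)
lemma structure_H {α : Type*} [Fintype α] (H : SimpleGraph α) (k : ℕ)
    (hthr : chromThreshold H = (2 * (k : ℝ) + 1) / (2 * (k : ℝ) + 3)) :
    ∃ col : α → Option (Fin (k + 1)),
      (∀ a b i, col a = some i → col b = some i → ¬ H.Adj a b) ∧
      (∀ T : Finset α, (∀ a ∈ T, col a = none) → T.Nonempty →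
        ∃ a ∈ T, (T.filter (fun b => H.Adj a b)).card ≤ 1) := by
  have hk : (0 : ℝ) ≤ k := Nat.cast_nonneg k
  unfold chromThreshold at hthr
  set S := {d : ℝ | 0 < d ∧ ∃ C : ℕ, ∀ (n : ℕ) (G : SimpleGraph (Fin n)),
    ¬ ContainsCopy H G → (∀ v, d * n ≤ ((G.neighborSet v).ncard : ℝ)) →
    G.chromaticNumber ≤ (C : ℕ∞) } with hS
  have hne : S.Nonempty := by
    by_contra h
    rw [Set.not_nonempty_iff_eq_empty] at h
    rw [h, Real.sInf_empty] at hthr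
    have : 0 < (2 * (k : ℝ) + 1) / (2 * (k : ℝ) + 3) := by positivity
    linarith
  have hlt : sInf S < ((k : ℝ) + 1) / (k + 2) := by
    rw [hthr, div_lt_div_iff₀ (by positivity) (by positivity)]
    nlinarith
  obtain ⟨d, ⟨hd0, C, hC⟩, hd⟩ := exists_lt_of_csInf_lt hne hlt
  rw [lt_div_iff₀ (by positivity)] at hd
  obtain ⟨N, Γ, hΓ, hsp⟩ := high_girth (C + 1) (Fintype.card α) (by omega)
  have hN : 0 < N := by
    rcases Nat.eq_zero_or_pos N with rfl | h
    · exact absurd (show Γ.Colorable (C + 1) from ⟨SimpleGraph.Coloring.mk (fun x => x.elim0) (fun {a} => a.elim0)⟩) hΓ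
    · exact h
  let G : SimpleGraph (Option (Fin (k + 1)) × Fin N) :=
    { Adj := fun p q => p.1 ≠ q.1 ∨ (p.1 = none ∧ q.1 = none ∧ Γ.Adj p.2 q.2)
      symm := ⟨by
        rintro p q (h | ⟨h1, h2, h3⟩)
        · exact Or.inl h.symm
        · exact Or.inr ⟨h2, h1, h3.symm⟩⟩
      loopless := ⟨by
        rintro p (h | ⟨_, _, h⟩)
        · exact h rfl
        · exact Γ.loopless.irrefl _ h⟩ }
  have hcard : Fintype.card (Option (Fin (k + 1)) × Fin N) = (k + 2) * N := by
    simp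
  let e := Fintype.equivFinOfCardEq hcard
  let G' : SimpleGraph (Fin ((k + 2) * N)) := G.comap e.symm
  have hcop : ContainsCopy H G' := by
    by_contra hcon
    have h1 := hC _ G' hcon (by
      intro v
      set A : Finset (Option (Fin (k + 1)) × Fin N) := (Finset.univ.erase (e.symm v).1) ×ˢ Finset.univ with hA
      have hsub : ((A.image e : Finset (Fin ((k + 2) * N))) : Set (Fin ((k + 2) * N))) ⊆ G'.neighborSet v := by
        intro w hw
        rw [Finset.mem_coe, Finset.mem_image] at hw
        obtain ⟨p, hp, rfl⟩ := hw
        rw [SimpleGraph.mem_neighborSet]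
        change G.Adj (e.symm v) (e.symm (e p))
        rw [Equiv.symm_apply_apply]
        left
        simp [hA] at hp
        exact fun h => hp h.symm
      have h2 := Set.ncard_le_ncard hsub (Set.toFinite _)
      rw [Set.ncard_coe_finset, Finset.card_image_of_injective _ e.injective, hA, Finset.card_product,
        Finset.card_erase_of_mem (Finset.mem_univ _)] at h2
      simp at h2
      have h3 : ((k : ℝ) + 1) * N ≤ ((G'.neighborSet v).ncard : ℝ) := by exact_mod_cast h2
      have h4 : (0 : ℝ) < N := by exact_mod_cast hN
      push_cast
      nlinarith)
    rw [SimpleGraph.chromaticNumber_le_iff_colorable] at h1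
    obtain ⟨c⟩ := h1
    apply hΓ
    refine SimpleGraph.Colorable.mono (Nat.le_succ C) ⟨SimpleGraph.Coloring.mk (fun x => c (e (none, x))) ?_⟩
    intro a b hab
    apply c.valid
    change G.Adj (e.symm _) (e.symm _)
    rw [Equiv.symm_apply_apply, Equiv.symm_apply_apply]
    right
    exact ⟨rfl, rfl, hab⟩
  obtain ⟨f, hf, hadj⟩ := hcop
  have hadj' : ∀ a b, H.Adj a b → G.Adj (e.symm (f a)) (e.symm (f b)) := fun a b h => hadj h
  refine ⟨fun a => (e.symm (f a)).1, ?_, ?_⟩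
  · intro a b i ha hb hab
    rcases hadj' a b hab with h | ⟨h, _⟩
    · exact h (ha.trans hb.symm)
    · exact absurd (h.symm.trans ha) (by simp)
  · intro T hT hTne
    let g : α → Fin N := fun a => (e.symm (f a)).2
    have ginj : Set.InjOn g T := by
      intro a ha b hb hab
      apply hf
      apply e.symm.injective
      exact Prod.ext ((hT a ha).trans (hT b hb).symm) hab
    obtain ⟨v, hv, hdeg⟩ := hsp (T.image g) (hTne.image g)
      (Finset.card_image_le.trans (Finset.card_le_univ T))
    obtain ⟨a, ha, rfl⟩ := Finset.mem_image.1 hv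
    refine ⟨a, ha, le_trans ?_ hdeg⟩
    apply Finset.card_le_card_of_injOn g
    · intro b hb
      have hb' := Finset.mem_filter.1 hb
      rw [Finset.mem_coe, Finset.mem_filter]
      refine ⟨Finset.mem_image_of_mem g hb'.1, ?_⟩
      rcases hadj' a b hb'.2 with h | ⟨_, _, h⟩
      · exact absurd ((hT a ha).trans (hT b hb'.1).symm) h
      · exact h
    · intro b hb c hc hbc
      exact ginj (Finset.mem_filter.1 hb).1 (Finset.mem_filter.1 hc).1 hbc
lemma quad_key {V : Type*} (ν : V → ℝ) (hpos : ∀ v, 0 < ν v) (a : ℝ) (S : Finset V) :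
    2 * a * S.card - a ^ 2 * ∑ v ∈ S, 1 / ν v ≤ ∑ v ∈ S, ν v := by
  have : 2 * a * S.card - a ^ 2 * ∑ v ∈ S, 1 / ν v = ∑ v ∈ S, (2 * a - a ^ 2 * (1 / ν v)) := by
    rw [Finset.sum_sub_distrib, Finset.sum_const, nsmul_eq_mul, Finset.mul_sum]
    ring
  rw [this]
  apply Finset.sum_le_sum
  intro v _
  have h := hpos v
  rw [sub_le_iff_le_add, ← sub_nonneg]
  have : ν v + a ^ 2 * (1 / ν v) - 2 * a = (ν v - a) ^ 2 / ν v := by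
    field_simp
    ring
  rw [this]
  positivity

lemma real_ineq (k b c θ X Y n SR SQ SV ρ q : ℝ) (hk : 0 ≤ k) (hn0 : 0 ≤ n)
    (hc : 0 < c) (hc1 : c ≤ 1) (hθ : 0 ≤ θ) (hb1 : b ≤ 1)
    (hbX : X ≤ b) (hXY : Y ≤ X) (hY : 0 ≤ Y) (h2X : b + Y ≤ 2 * X)
    (hX : X = 2 - 2 * (k + 1) * b) (hsum : k * b + X + Y = 1)
    (hR : SR ≤ (k + θ) * n) (hQ : SQ ≤ (k + 1 + θ) * n)
    (hV : SV ≤ (k + 2 + θ) * n) (hcard : 2 * (1 - b) * n ≤ ρ + q)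
    (hRc : ρ ≤ (b + c) * ((k + θ) * n)) :
    n * (k * b ^ 2 + X ^ 2 + Y ^ 2 - 5 * θ - 2 * c * k) ≤
      (2 * b * ρ - b ^ 2 * SR) + (2 * X * (q - ρ) - X ^ 2 * (SQ - SR)) +
        (2 * Y * (n - q) - Y ^ 2 * (SV - SQ)) := by
  have hX0 : 0 ≤ X := hY.trans hXY
  have hb0 : 0 ≤ b := by linarith
  have t1 : (b ^ 2 - X ^ 2) * SR ≤ (b ^ 2 - X ^ 2) * ((k + θ) * n) :=
    mul_le_mul_of_nonneg_left hR (by nlinarith)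
  have t2 : (X ^ 2 - Y ^ 2) * SQ ≤ (X ^ 2 - Y ^ 2) * ((k + 1 + θ) * n) :=
    mul_le_mul_of_nonneg_left hQ (by nlinarith)
  have t3 : Y ^ 2 * SV ≤ Y ^ 2 * ((k + 2 + θ) * n) := mul_le_mul_of_nonneg_left hV (by positivity)
  have t4 : (X - Y) * (2 * (1 - b) * n - ρ) ≤ (X - Y) * q :=
    mul_le_mul_of_nonneg_left (by linarith) (by linarith)
  have t5 : (2 * X - b - Y) * ρ ≤ (2 * X - b - Y) * ((b + c) * ((k + θ) * n)) :=
    mul_le_mul_of_nonneg_left hRc (by linarith)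
  have t6 : (2 * X - b - Y) * ((b * θ + c * k + c * θ) * n) ≤ 1 * ((θ + c * k + θ) * n) := by
    apply mul_le_mul (by linarith) _ (by positivity) (by norm_num)
    apply mul_le_mul_of_nonneg_right _ hn0
    have e1 : b * θ ≤ 1 * θ := mul_le_mul_of_nonneg_right hb1 hθ
    have e2 : c * θ ≤ 1 * θ := mul_le_mul_of_nonneg_right hc1 hθ
    linarith
  have t7 : b ^ 2 * (θ * n) ≤ 1 * (θ * n) :=
    mul_le_mul_of_nonneg_right (by nlinarith) (by positivity)
  have main : (b - 2 * X + Y) * (b * k) + 2 * (X - Y) * (1 - b) + Y = k * b ^ 2 + X ^ 2 + Y ^ 2 := by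
    have hY' : Y = 1 - k * b - X := by linarith
    rw [hY', hX]; ring
  have main' : ((b - 2 * X + Y) * (b * k) + 2 * (X - Y) * (1 - b) + Y) * n =
    (k * b ^ 2 + X ^ 2 + Y ^ 2) * n := by rw [main]
  linarith

lemma analytic {V : Type*} [Fintype V] (k : ℕ) (b c θ X Y n : ℝ) (ν : V → ℝ) (R Q : Finset V)
    (hRQ : R ⊆ Q) (hn : n = Fintype.card V) (hc : 0 < c) (hc1 : c ≤ 1) (hθ : 0 ≤ θ) (hb1 : b ≤ 1)
    (hbX : X ≤ b) (hXY : Y ≤ X) (hY : 0 ≤ Y) (h2X : b + Y ≤ 2 * X)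
    (hX : X = 2 - 2 * (k + 1) * b) (hsum : k * b + X + Y = 1)
    (hν : ∀ v, c ≤ ν v) (hν' : ∀ v, ν v ≤ b + c)
    (hR : ∑ v ∈ R, 1 / ν v ≤ (k + θ) * n) (hQ : ∑ v ∈ Q, 1 / ν v ≤ (k + 1 + θ) * n)
    (hV : ∑ v, 1 / ν v ≤ (k + 2 + θ) * n) (hcard : 2 * (1 - b) * n ≤ (R.card : ℝ) + Q.card) :
    n * (k * b ^ 2 + X ^ 2 + Y ^ 2 - 5 * θ - 2 * c * k) ≤ ∑ v, ν v := by
  have hpos : ∀ v, 0 < ν v := fun v => lt_of_lt_of_le hc (hν v)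
  have hn0 : 0 ≤ n := by rw [hn]; positivity
  have h1 := quad_key ν hpos b R
  have h2 := quad_key ν hpos X (Q \ R)
  have h3 := quad_key ν hpos Y (Finset.univ \ Q)
  have s1 : ∀ g : V → ℝ, ∑ v ∈ Q \ R, g v = ∑ v ∈ Q, g v - ∑ v ∈ R, g v := by
    intro g
    rw [eq_sub_iff_add_eq, Finset.sum_sdiff hRQ]
  have s2 : ∀ g : V → ℝ, ∑ v ∈ Finset.univ \ Q, g v = ∑ v, g v - ∑ v ∈ Q, g v := by
    intro g
    rw [eq_sub_iff_add_eq, Finset.sum_sdiff (Finset.subset_univ Q)]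
  have c1 : ((Q \ R).card : ℝ) = Q.card - R.card := by
    rw [Finset.cast_card_sdiff hRQ]
  have c2 : ((Finset.univ \ Q).card : ℝ) = n - Q.card := by
    rw [Finset.cast_card_sdiff (Finset.subset_univ Q), hn, Finset.card_univ]
  rw [s1, s1, c1] at h2
  rw [s2, s2, c2] at h3
  have hbc : 0 ≤ b + c := by linarith
  have hRc : (R.card : ℝ) ≤ (b + c) * ((k + θ) * n) := by
    calc (R.card : ℝ) = ∑ v ∈ R, (1 : ℝ) := by simp
      _ ≤ ∑ v ∈ R, (b + c) * (1 / ν v) := by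
          apply Finset.sum_le_sum
          intro v _
          rw [mul_one_div, le_div_iff₀ (hpos v), one_mul]
          exact hν' v
      _ = (b + c) * ∑ v ∈ R, 1 / ν v := by rw [Finset.mul_sum]
      _ ≤ _ := mul_le_mul_of_nonneg_left hR hbc
  have := real_ineq k b c θ X Y n _ _ _ _ _ (Nat.cast_nonneg k) hn0 hc hc1 hθ hb1 hbX hXY hY h2X hX hsum
    hR hQ hV hcard hRc
  linarith

lemma nb_union_inter {V : Type*} [Fintype V] (A B : Finset V) :
    ((A ∩ B).card : ℝ) + (A ∪ B).card = A.card + B.card := by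
  have := Finset.card_union_add_card_inter A B
  have h : ((A ∪ B).card : ℝ) + (A ∩ B).card = A.card + B.card := by exact_mod_cast this
  linarith

lemma core_pair {V : Type*} [Fintype V] [Nonempty V] (G : SimpleGraph V) (k : ℕ)
    (b c η θ X Y E : ℝ)
    (hc : 0 < c) (hc1 : c ≤ 1) (hη : 0 ≤ η) (hθ : ((k : ℝ) + 3) * (η / c) = θ) (hb1 : b ≤ 1)
    (hbX : X ≤ b) (hXY : Y ≤ X) (hY : 0 ≤ Y) (h2X : b + Y ≤ 2 * X)
    (hX : X = 2 - 2 * (k + 1) * b) (hsum : k * b + X + Y = 1)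
    (hdeg : ∀ v, (1 - b) * Fintype.card V ≤ ((nb G v).card : ℝ))
    (hE : ∑ v, ((nb G v).card : ℝ) = 2 * E)
    (hElow : (1 - (k * b ^ 2 + X ^ 2 + Y ^ 2) + c * (2 * k + 1) + 5 * θ) * (Fintype.card V : ℝ) ^ 2 < 2 * E)
    (hV : (cliqCount G (k + 3) Finset.univ : ℝ) < (η * Fintype.card V) ^ (k + 3))
    (u v : V)
    (hQ : (cliqCount G (k + 2) (nb G u ∪ nb G v) : ℝ) < (η * Fintype.card V) ^ (k + 2)) :
    (η * Fintype.card V) ^ (k + 1) ≤ (cliqCount G (k + 1) (nb G u ∩ nb G v) : ℝ) := by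
  by_contra hR
  push Not at hR
  set n : ℝ := (Fintype.card V : ℝ) with hn
  have hn0 : 0 < n := by rw [hn]; exact_mod_cast Fintype.card_pos
  have hk : (0 : ℝ) ≤ k := Nat.cast_nonneg k
  set ν : V → ℝ := fun w => (n - (nb G w).card) / n + c with hν
  have hle : ∀ w, ((nb G w).card : ℝ) ≤ n := by
    intro w; rw [hn]; exact_mod_cast Finset.card_le_univ _
  have hν1 : ∀ w, c ≤ ν w := by
    intro w
    have : 0 ≤ (n - (nb G w).card) / n := div_nonneg (by linarith [hle w]) hn0.le
    simp only [hν]; linarith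
  have hν2 : ∀ w, ν w ≤ b + c := by
    intro w
    have : (n - (nb G w).card) / n ≤ b := by
      rw [div_le_iff₀ hn0]; linarith [hdeg w]
    simp only [hν]; linarith
  have hpos : ∀ w, 0 < ν w := fun w => lt_of_lt_of_le hc (hν1 w)
  have hcw : ∀ (j : ℕ) (S : Finset V), j ≤ k + 2 → (cliqCount G (j + 1) S : ℝ) < (η * n) ^ (j + 1) →
      ∑ w ∈ S, 1 / ν w ≤ (j + θ) * n := by
    intro j S hj hlt
    by_contra hcon
    push Not at hcon
    have := caro_wei G (fun w => n * ν w) (c * n) (η * n) (by positivity) (by positivity)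
      (fun w => by rw [mul_comm]; exact mul_le_mul_of_nonneg_left (hν1 w) hn0.le)
      (fun w => by
        have h1 : (Finset.univ.filter (fun u => ¬ G.Adj w u)).card + (nb G w).card = Fintype.card V := by
          rw [nb, add_comm, Finset.card_filter_add_card_filter_not]
          rfl
        have h2 : ((Finset.univ.filter (fun u => ¬ G.Adj w u)).card : ℝ) = n - (nb G w).card := by
          rw [hn, ← h1]; push_cast; ring
        rw [h2]
        simp only [hν]
        rw [mul_add, mul_div_cancel₀ _ hn0.ne']
        nlinarith) j S (by
        have h3 : ∑ w ∈ S, 1 / (n * ν w) = (∑ w ∈ S, 1 / ν w) / n := by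
          rw [Finset.sum_div]
          apply Finset.sum_congr rfl
          intro w _
          rw [mul_comm, div_div]
        rw [h3, le_div_iff₀ hn0]
        have h4 : η * n / (c * n) = η / c := by field_simp
        rw [h4]
        refine le_trans ?_ hcon.le
        apply mul_le_mul_of_nonneg_right _ hn0.le
        rw [← hθ]
        have h5 : (j : ℝ) ≤ k + 2 := by exact_mod_cast hj
        have h6 : 0 ≤ η / c := by positivity
        nlinarith)
    linarith
  have hθ0 : 0 ≤ θ := by rw [← hθ]; positivity
  have a1 := hcw k _ (by omega) hR
  have a2 := hcw (k + 1) _ (by omega) hQ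
  have a3 := hcw (k + 2) _ (by omega) hV
  push_cast at a2 a3
  have hfin := analytic k b c θ X Y n ν (nb G u ∩ nb G v) (nb G u ∪ nb G v)
    (Finset.inter_subset_left.trans Finset.subset_union_left) hn hc hc1 hθ0 hb1 hbX hXY hY h2X hX hsum
    hν1 hν2 a1 a2 a3 (by
      rw [nb_union_inter]
      linarith [hdeg u, hdeg v])
  have hs : ∑ w, ν w = (n * n - 2 * E) / n + c * n := by
    simp only [hν]
    rw [Finset.sum_add_distrib, ← Finset.sum_div, Finset.sum_sub_distrib, hE]
    simp only [Finset.sum_const, nsmul_eq_mul, Finset.card_univ, ← hn]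
    ring
  rw [hs] at hfin
  have h7 : n * (n * (k * b ^ 2 + X ^ 2 + Y ^ 2 - 5 * θ - 2 * c * k)) ≤ n * ((n * n - 2 * E) / n + c * n) :=
    mul_le_mul_of_nonneg_left hfin hn0.le
  rw [mul_add, mul_div_cancel₀ _ hn0.ne'] at h7
  nlinarith
lemma sum_nb_card {V : Type*} [Fintype V] (G : SimpleGraph V) :
    ∑ v, ((nb G v).card : ℝ) = 2 * (G.edgeSet.ncard : ℝ) := by
  have h := G.sum_degrees_eq_twice_card_edges
  have h2 : G.edgeSet.ncard = G.edgeFinset.card := by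
    rw [← Set.ncard_coe_finset, SimpleGraph.coe_edgeFinset]
  have h3 : ∑ v, (nb G v).card = 2 * G.edgeSet.ncard := by
    rw [h2, ← h]
    apply Finset.sum_congr rfl
    intro v _
    rw [← SimpleGraph.card_neighborFinset_eq_degree]
    congr 1
    ext w
    simp [nb]
  exact_mod_cast h3

lemma ncard_neighborSet {V : Type*} [Fintype V] (G : SimpleGraph V) (v : V) :
    (G.neighborSet v).ncard = (nb G v).card := by
  rw [← Set.ncard_coe_finset]
  congr 1
  ext w
  simp [nb]

lemma main_core {α : Type*} [Fintype α] (H : SimpleGraph α) (k : ℕ) (hH : H.Colorable (k + 3))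
    (col : α → Option (Fin (k + 1)))
    (hcol : ∀ a b i, col a = some i → col b = some i → ¬ H.Adj a b)
    (hF : ∀ T : Finset α, (∀ a ∈ T, col a = none) → T.Nonempty →
        ∃ a ∈ T, (T.filter (fun b => H.Adj a b)).card ≤ 1)
    (b X Y ε : ℝ) (hε : 0 < ε) (hb1 : b ≤ 1)
    (hbX : X ≤ b) (hXY : Y ≤ X) (hY : 0 ≤ Y) (h2X : b + Y ≤ 2 * X)
    (hX : X = 2 - 2 * (k + 1) * b) (hsum : k * b + X + Y = 1) :
    ∃ (C n₀ : ℕ), ∀ (V : Type) [Fintype V], n₀ ≤ Fintype.card V → ∀ G : SimpleGraph V,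
      ¬ ContainsCopy H G → (∀ v, (1 - b) * Fintype.card V ≤ ((nb G v).card : ℝ)) →
      (1 - (k * b ^ 2 + X ^ 2 + Y ^ 2) + 2 * ε) * (Fintype.card V : ℝ) ^ 2 <
        ∑ v, ((nb G v).card : ℝ) → G.Colorable C := by
  have hk : (0 : ℝ) ≤ k := Nat.cast_nonneg k
  set s := Fintype.card α with hs
  obtain ⟨c, hc, hc1, hcε⟩ : ∃ c : ℝ, 0 < c ∧ c ≤ 1 ∧ c * (2 * k + 1) ≤ ε := by
    refine ⟨min 1 (ε / (2 * k + 1)), by positivity, min_le_left _ _, ?_⟩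
    rw [← le_div_iff₀ (by positivity)]
    exact min_le_right _ _
  set θ : ℝ := ε / 10 with hθ
  set η : ℝ := θ * c / (k + 3) with hη
  have hη0 : 0 < η := by positivity
  have hθη : ((k : ℝ) + 3) * (η / c) = θ := by rw [hη]; field_simp
  set γ : ℝ := min (η ^ (k + 2) / (4 * 2 ^ (k + 2))) (η ^ (k + 3) / 4) with hγ
  have hγ0 : 0 < γ := by positivity
  have hγ1 : 2 ^ (k + 2) * γ ≤ η ^ (k + 2) / 4 := by
    have : γ ≤ η ^ (k + 2) / (4 * 2 ^ (k + 2)) := min_le_left _ _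
    rw [le_div_iff₀ (by positivity)] at this
    linarith
  have hγ2 : γ ≤ η ^ (k + 3) / 4 := min_le_right _ _
  set τ : ℝ := η ^ (k + 2) / (4 * (k + 2) * 2 ^ (k + 2)) with hτ
  have hτ0 : 0 < τ := by positivity
  have hτ1 : ((k : ℝ) + 2) * 2 ^ (k + 2) * τ = η ^ (k + 2) / 4 := by
    rw [hτ]; field_simp
  obtain ⟨εB, hεB, nB, hB⟩ := many_blow (k + 2) s γ hγ0
  obtain ⟨εA, hεA, nA, hA⟩ := many_blow (k + 1) s (η ^ (k + 1)) (by positivity)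
  obtain ⟨C0, hC0⟩ := exists_nat_ge ((s : ℝ) / εB)
  obtain ⟨L, hL⟩ := exists_nat_ge ((2 * s : ℝ) / εA)
  rw [div_le_iff₀ hεB] at hC0
  rw [div_le_iff₀ hεA] at hL
  obtain ⟨M, hM⟩ := types_lemma τ hτ0
  obtain ⟨n1, hn1⟩ := exists_nat_gt ((C0 : ℝ) / (η ^ (k + 3) / 4))
  rw [div_lt_iff₀ (by positivity)] at hn1
  refine ⟨Fintype.card (Fin C0 ⊕ (Fin M × Fin (L + 1))), nA + nB + n1 + 1, ?_⟩
  intro V _ hn₀ G hG hdeg hedge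
  have : Nonempty V := Fintype.card_pos_iff.1 (by omega)
  set n : ℝ := (Fintype.card V : ℝ) with hn
  have hn0 : 0 < n := by rw [hn]; exact_mod_cast Fintype.card_pos
  have hn1' : (n1 : ℝ) ≤ n := by
    rw [hn]
    have : n1 ≤ Fintype.card V := by omega
    exact_mod_cast this
  set B : Finset V := Finset.univ.filter (fun w => γ * n ^ (k + 2) ≤ (cliqCount G (k + 2) (nb G w) : ℝ)) with hBdef
  have hBc : (B.card : ℝ) ≤ C0 := by
    have h1 := exceptional_bound H (k + 2) hH G hG εB B (by
      intro w hw
      exact hB V (by omega) G (nb G w) (Finset.mem_filter.1 hw).2)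
    have h2 : εB * B.card ≤ εB * C0 := by linarith
    exact le_of_mul_le_mul_left h2 hεB
  have hcl_le : ∀ w, (cliqCount G (k + 2) (nb G w) : ℝ) ≤ n ^ (k + 2) := by
    intro w
    have : cliqCount G (k + 2) (nb G w) ≤ Fintype.card V ^ (k + 2) := by
      unfold cliqCount
      refine (Finset.card_le_univ _).trans (le_of_eq ?_)
      simp
    rw [hn]
    exact_mod_cast this
  have hVcount : (cliqCount G (k + 3) Finset.univ : ℝ) < (η * n) ^ (k + 3) := by
    have h1 : (cliqCount G (k + 3) Finset.univ : ℝ) = ∑ w, (cliqCount G (k + 2) (nb G w) : ℝ) := by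
      rw [cliqCount_succ]
      push_cast
      rfl
    rw [h1]
    have h2 : ∑ w, (cliqCount G (k + 2) (nb G w) : ℝ) ≤
        ∑ w, ((if w ∈ B then n ^ (k + 2) else 0) + γ * n ^ (k + 2)) := by
      apply Finset.sum_le_sum
      intro w _
      split_ifs with h
      · have : 0 ≤ γ * n ^ (k + 2) := by positivity
        linarith [hcl_le w]
      · have : ¬ γ * n ^ (k + 2) ≤ (cliqCount G (k + 2) (nb G w) : ℝ) := by
          intro h'
          exact h (Finset.mem_filter.2 ⟨Finset.mem_univ _, h'⟩)
        linarith
    have h3 : ∑ w : V, ((if w ∈ B then n ^ (k + 2) else 0) + γ * n ^ (k + 2)) =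
        B.card * n ^ (k + 2) + n * (γ * n ^ (k + 2)) := by
      rw [Finset.sum_add_distrib]
      simp [hn]
    rw [h3] at h2
    refine lt_of_le_of_lt h2 ?_
    have h4 : (B.card : ℝ) * n ^ (k + 2) ≤ (n * (η ^ (k + 3) / 4)) * n ^ (k + 2) := by
      apply mul_le_mul_of_nonneg_right _ (by positivity)
      have : (n1 : ℝ) * (η ^ (k + 3) / 4) ≤ n * (η ^ (k + 3) / 4) :=
        mul_le_mul_of_nonneg_right hn1' (by positivity)
      linarith
    have h5 : n * (γ * n ^ (k + 2)) ≤ n * (η ^ (k + 3) / 4 * n ^ (k + 2)) := by gcongr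
    have h6 : 0 < η ^ (k + 3) * n ^ (k + 3) := by positivity
    have h7 : n ^ (k + 3) = n * n ^ (k + 2) := by ring
    rw [mul_pow]
    rw [h7] at h6 ⊢
    linarith
  obtain ⟨cls, hcls⟩ := hM V (Fin (k + 1) → V) (fun y => extSet G y) (fun u => nb G u)
  have hcardY : (Fintype.card (Fin (k + 1) → V) : ℝ) = n ^ (k + 1) := by simp [hn]
  rw [hcardY, ← hn] at hcls
  have hpair : ∀ u v, u ∉ B → cls u = cls v →
      (η * n) ^ (k + 1) ≤ (cliqCount G (k + 1) (nb G u ∩ nb G v) : ℝ) := by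
    intro u v hu huv
    refine core_pair G k b c η θ X Y (G.edgeSet.ncard) hc hc1 hη0.le hθη hb1 hbX hXY hY h2X hX hsum hdeg
      (sum_nb_card G) ?_ hVcount u v ?_
    · rw [← sum_nb_card]
      refine lt_of_le_of_lt ?_ hedge
      apply mul_le_mul_of_nonneg_right _ (by positivity)
      linarith
    · have h1 := swap_lemma G (k + 1) (nb G u) (nb G v) (τ * n * n ^ (k + 1)) (by positivity) (hcls u v huv)
      have h2 : ¬ γ * n ^ (k + 2) ≤ (cliqCount G (k + 2) (nb G u) : ℝ) := by
        intro h'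
        exact hu (Finset.mem_filter.2 ⟨Finset.mem_univ _, h'⟩)
      push Not at h2
      push_cast at h1
      refine lt_of_le_of_lt h1 ?_
      have h3 : (2 : ℝ) ^ (k + 2) * cliqCount G (k + 2) (nb G u) ≤ 2 ^ (k + 2) * (γ * n ^ (k + 2)) := by
        gcongr
      have h4 : (2 : ℝ) ^ (k + 2) * (γ * n ^ (k + 2)) ≤ η ^ (k + 2) / 4 * n ^ (k + 2) := by
        rw [← mul_assoc]; gcongr
      have h5 : ((k : ℝ) + 1 + 1) * 2 ^ (k + 1 + 1) * (τ * n * n ^ (k + 1)) = η ^ (k + 2) / 4 * n ^ (k + 2) := by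
        rw [← hτ1]; ring
      have h6 : 0 < η ^ (k + 2) * n ^ (k + 2) := by positivity
      rw [mul_pow, h5]
      linarith
  have hclass : ∀ i : Fin M, ∃ cc : V → Fin (L + 1), ∀ u ∈ Finset.univ.filter (fun w => w ∉ B ∧ cls w = i),
      ∀ v ∈ Finset.univ.filter (fun w => w ∉ B ∧ cls w = i), G.Adj u v → cc u ≠ cc v := by
    intro i
    apply color_degenerate
    refine class_degenerate H (k + 1) col hcol hF G hG εA hεA L (by linarith) _ ?_
    intro u hu v hv huv
    simp only [Finset.mem_filter, Finset.mem_univ, true_and] at hu hv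
    refine hA V (by omega) G (nb G u ∩ nb G v) ?_
    rw [← mul_pow]
    exact hpair u v hu.1 (hu.2.trans hv.2.symm)
  choose cc hcc using hclass
  obtain ⟨g⟩ : Nonempty (B ↪ Fin C0) := Function.Embedding.nonempty_of_card_le (by
    rw [Fintype.card_coe, Fintype.card_fin]; exact_mod_cast hBc)
  let F : V → Fin C0 ⊕ (Fin M × Fin (L + 1)) := fun v =>
    if h : v ∈ B then Sum.inl (g ⟨v, h⟩) else Sum.inr (cls v, cc (cls v) v)
  refine (SimpleGraph.Coloring.mk F ?_).colorable
  intro u v huv heq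
  simp only [F] at heq
  by_cases hu : u ∈ B <;> by_cases hv : v ∈ B
  · rw [dif_pos hu, dif_pos hv] at heq
    have := g.injective (Sum.inl_injective heq)
    exact huv.ne (Subtype.ext_iff.1 this)
  · rw [dif_pos hu, dif_neg hv] at heq
    cases heq
  · rw [dif_neg hu, dif_pos hv] at heq
    cases heq
  · rw [dif_neg hu, dif_neg hv] at heq
    have h1 := Prod.ext_iff.1 (Sum.inr_injective heq)
    simp only at h1
    refine hcc (cls u) u ?_ v ?_ huv ?_
    · simp [hu]
    · simp [hv, h1.1]
    · rw [h1.2, h1.1]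
end Helpers

theorem stmt_0 {α : Type*} [Fintype α] (H : SimpleGraph α) (r : ℕ) (hr : 3 ≤ r)
    (hchi : H.chromaticNumber = (r : ℕ∞))
    (hthr : chromThreshold H = (2 * (r : ℝ) - 5) / (2 * (r : ℝ) - 3))
    (δ : ℝ) (hδl : (5 * (r : ℝ) - 13) / (5 * (r : ℝ) - 8) < δ)
    (hδu : δ ≤ (2 * (r : ℝ) - 5) / (2 * (r : ℝ) - 3))
    (ε : ℝ) (hε : 0 < ε) :
    ∃ (C : ℕ) (n₀ : ℕ), ∀ n : ℕ, n₀ ≤ n → ∀ G : SimpleGraph (Fin n),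
      ¬ ContainsCopy H G →
      (∀ v, δ * n ≤ ((G.neighborSet v).ncard : ℝ)) →
      (((-5 * (r : ℝ) ^ 2 + 17 * r - 14) * δ ^ 2 + (10 * (r : ℝ) ^ 2 - 44 * r + 46) * δ
          - 5 * (r : ℝ) ^ 2 + 27 * r - 36) / 2 + ε) * n ^ 2 < (G.edgeSet.ncard : ℝ) →
      G.chromaticNumber ≤ (C : ℕ∞) := by
  obtain ⟨k, rfl⟩ : ∃ k, r = k + 3 := ⟨r - 3, by omega⟩
  have hk : (0 : ℝ) ≤ k := Nat.cast_nonneg k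
  push_cast at hthr hδl hδu ⊢
  rw [show 2 * ((k : ℝ) + 3) - 5 = 2 * k + 1 by ring, show 2 * ((k : ℝ) + 3) - 3 = 2 * k + 3 by ring] at hthr hδu
  rw [show 5 * ((k : ℝ) + 3) - 13 = 5 * k + 2 by ring, show 5 * ((k : ℝ) + 3) - 8 = 5 * k + 7 by ring] at hδl
  obtain ⟨col, hcol, hF⟩ := structure_H H k hthr
  have hH : H.Colorable (k + 3) := SimpleGraph.chromaticNumber_le_iff_colorable.1 (le_of_eq hchi)
  rw [div_lt_iff₀ (by positivity)] at hδl
  rw [le_div_iff₀ (by positivity)] at hδu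
  have hδ0 : 0 < δ := by
    by_contra h
    push Not at h
    have : δ * (5 * k + 7) ≤ 0 := mul_nonpos_of_nonpos_of_nonneg h (by positivity)
    linarith
  obtain ⟨C, n₀, hmain⟩ := main_core H k hH col hcol hF (1 - δ) (2 - 2 * (k + 1) * (1 - δ))
    ((k + 2) * (1 - δ) - 1) ε hε (by linarith) (by linarith) (by nlinarith) (by nlinarith) (by nlinarith)
    rfl (by ring)
  refine ⟨C, n₀, ?_⟩
  intro n hn G hG hdeg hedge
  rw [SimpleGraph.chromaticNumber_le_iff_colorable]
  refine hmain (Fin n) (by simpa using hn) G hG ?_ ?_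
  · intro v
    rw [← ncard_neighborSet, Fintype.card_fin]
    linarith [hdeg v]
  · rw [sum_nb_card, Fintype.card_fin]
    refine lt_of_eq_of_lt ?_ (mul_lt_mul_of_pos_left hedge (by norm_num : (0 : ℝ) < 2))
    ring
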